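/- The commutator subgroup of the group Homeo(S²) of self-homeomorphisms of the 2-sphere (the unit sphere in ℝ³) has index 2 in Homeo(S²). -/

import Mathlib

open Pointwise

instance instGroupHomeomorph (X : Type*) [TopologicalSpace X] : Group (X ≃ₜ X) where
  mul f g := g.trans f
  one := Homeomorph.refl X
  inv := Homeomorph.symm
  mul_assoc _ _ _ := Homeomorph.ext fun _ => rfl
  one_mul _ := Homeomorph.ext fun _ => rfl
  mul_one _ := Homeomorph.ext fun _ => rfl
  inv_mul_cancel f := Homeomorph.ext fun x => f.symm_apply_apply x

namespace SphereHomeo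
open OnePoint Filter Topology

/-- The extension of a homeomorphism of the plane to the Riemann sphere, fixing `∞`. -/
noncomputable def ptExt : (ℂ ≃ₜ ℂ) →* (OnePoint ℂ ≃ₜ OnePoint ℂ) where
  toFun := Homeomorph.onePointCongr
  map_one' := by ext x; induction x <;> rfl
  map_mul' f g := by ext x; induction x <;> rfl

@[simp] lemma ptExt_coe (f : ℂ ≃ₜ ℂ) (z : ℂ) : ptExt f (z : OnePoint ℂ) = (f z : ℂ) := rfl

@[simp] lemma ptExt_infty (f : ℂ ≃ₜ ℂ) : ptExt f ∞ = ∞ := rfl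

@[simp] lemma ptExt_symm (f : ℂ ≃ₜ ℂ) : (ptExt f).symm = ptExt f.symm := rfl

lemma exists_ptExt_eq (h : OnePoint ℂ ≃ₜ OnePoint ℂ) (hh : h ∞ = ∞) : ∃ g, ptExt g = h := by
  have key : ∀ k : OnePoint ℂ ≃ₜ OnePoint ℂ, k ∞ = ∞ →
      ∃ f : ℂ → ℂ, Continuous f ∧ ∀ z : ℂ, k z = (f z : ℂ) := by
    intro k hk
    have : ∀ z : ℂ, ∃ w : ℂ, k z = w := by
      intro z
      have : k z ≠ ∞ := fun h ↦ by
        have := k.injective (h.trans hk.symm)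
        simp at this
      obtain ⟨w, hw⟩ := OnePoint.ne_infty_iff_exists.1 this
      exact ⟨w, hw.symm⟩
    choose f hf using this
    refine ⟨f, ?_, hf⟩
    rw [OnePoint.isOpenEmbedding_coe.isEmbedding.continuous_iff]
    have : (OnePoint.some ∘ f : ℂ → OnePoint ℂ) = k ∘ OnePoint.some := by
      ext z; simp [hf]
    rw [this]
    exact k.continuous.comp OnePoint.continuous_coe
  obtain ⟨f, hf, hf'⟩ := key h hh
  obtain ⟨g, hg, hg'⟩ := key h.symm (by rw [Homeomorph.symm_apply_eq, hh])
  refine ⟨⟨⟨f, g, fun z ↦ ?_, fun z ↦ ?_⟩, hf, hg⟩, ?_⟩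
  · apply OnePoint.coe_injective
    rw [← hg', ← hf', h.symm_apply_apply]
  · apply OnePoint.coe_injective
    rw [← hf', ← hg', h.apply_symm_apply]
  · ext x
    induction x with
    | infty => rw [hh]; rfl
    | coe z => rw [hf']; rfl

/-- The inversion `z ↦ z⁻¹` as a function on the Riemann sphere. -/
noncomputable def invFun : OnePoint ℂ → OnePoint ℂ :=
  OnePoint.rec ((0 : ℂ) : OnePoint ℂ) fun z ↦ if z = 0 then ∞ else ((z⁻¹ : ℂ) : OnePoint ℂ)

lemma invFun_infty : invFun ∞ = ((0 : ℂ) : OnePoint ℂ) := rfl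

lemma invFun_coe (z : ℂ) :
    invFun z = if z = 0 then ∞ else ((z⁻¹ : ℂ) : OnePoint ℂ) := rfl

lemma invFun_invFun (x : OnePoint ℂ) : invFun (invFun x) = x := by
  induction x with
  | infty => simp [invFun_infty, invFun_coe]
  | coe z =>
    by_cases hz : z = 0
    · simp [invFun_infty, invFun_coe, hz]
    · simp [invFun_coe, hz]

lemma continuous_invFun : Continuous invFun := by
  rw [continuous_iff_continuousAt]
  intro x
  induction x with
  | infty =>
    rw [OnePoint.continuousAt_infty', invFun_infty, coclosedCompact_eq_cocompact,
      ← Metric.cobounded_eq_cocompact]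
    have h1 : Tendsto (fun z : ℂ ↦ ((z⁻¹ : ℂ) : OnePoint ℂ)) (Bornology.cobounded ℂ)
        (𝓝 ((0 : ℂ) : OnePoint ℂ)) :=
      (OnePoint.continuous_coe.tendsto _).comp tendsto_inv₀_cobounded
    refine h1.congr' ?_
    filter_upwards [Bornology.eventually_ne_cobounded (0 : ℂ)] with z hz
    simp [invFun_coe, hz]
  | coe z =>
    rw [OnePoint.continuousAt_coe]
    by_cases hz : z = 0
    · subst hz
      rw [continuousAt_iff_punctured_nhds]
      have h2 : Tendsto (fun z : ℂ ↦ ((z⁻¹ : ℂ) : OnePoint ℂ)) (𝓝[≠] 0) (𝓝 ∞) := by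
        refine Tendsto.comp (y := Bornology.cobounded ℂ) ?_ tendsto_inv₀_nhdsNE_zero
        rw [Metric.cobounded_eq_cocompact, ← coclosedCompact_eq_cocompact]
        exact (OnePoint.tendsto_coe_infty)
      have h3 : (invFun ∘ OnePoint.some) (0 : ℂ) = ∞ := by simp [invFun_coe]
      rw [h3]
      refine h2.congr' ?_
      filter_upwards [self_mem_nhdsWithin] with z hz
      have : z ≠ 0 := hz
      simp [invFun_coe, this]
    · have h2 : ContinuousAt (fun z : ℂ ↦ ((z⁻¹ : ℂ) : OnePoint ℂ)) z :=
        OnePoint.continuous_coe.continuousAt.comp (continuousAt_inv₀ hz)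
      refine h2.congr ?_
      filter_upwards [isOpen_ne.mem_nhds hz] with w hw
      have : w ≠ 0 := hw
      simp [invFun_coe, this]

/-- The inversion `z ↦ z⁻¹` of the Riemann sphere. -/
noncomputable def inversion : OnePoint ℂ ≃ₜ OnePoint ℂ where
  toFun := invFun
  invFun := invFun
  left_inv := invFun_invFun
  right_inv := invFun_invFun
  continuous_toFun := continuous_invFun
  continuous_invFun := continuous_invFun

@[simp] lemma inversion_infty : inversion ∞ = ((0 : ℂ) : OnePoint ℂ) := rfl

lemma inversion_coe (z : ℂ) :
    inversion z = if z = 0 then ∞ else ((z⁻¹ : ℂ) : OnePoint ℂ) := rfl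

@[simp] lemma inversion_zero : inversion ((0 : ℂ) : OnePoint ℂ) = ∞ := by simp [inversion_coe]

lemma inversion_coe_of_ne {z : ℂ} (hz : z ≠ 0) :
    inversion z = ((z⁻¹ : ℂ) : OnePoint ℂ) := by simp [inversion_coe, hz]

@[simp] lemma inversion_inversion (x : OnePoint ℂ) : inversion (inversion x) = x :=
  invFun_invFun x

@[simp] lemma inversion_symm : inversion.symm = inversion := rfl

@[simp] lemma inversion_inv : inversion⁻¹ = inversion := rfl

/-- The affine map `z ↦ a z + b`. -/
noncomputable def aff (a : ℂˣ) (b : ℂ) : ℂ ≃ₜ ℂ where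
  toFun z := a * z + b
  invFun z := (a⁻¹ : ℂˣ) * (z - b)
  left_inv z := by simp
  right_inv z := by simp
  continuous_toFun := by fun_prop
  continuous_invFun := by fun_prop

@[simp] lemma aff_apply (a : ℂˣ) (b z : ℂ) : aff a b z = a * z + b := rfl

@[simp] lemma aff_symm_apply (a : ℂˣ) (b z : ℂ) : (aff a b).symm z = (a⁻¹ : ℂˣ) * (z - b) := rfl

/-- Complex conjugation. -/
noncomputable def conjHomeo : ℂ ≃ₜ ℂ := Complex.conjCLE.toHomeomorph

@[simp] lemma conjHomeo_apply (z : ℂ) : conjHomeo z = (starRingEnd ℂ) z := rfl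

section Abelian
variable {A : Type*} [CommGroup A] (π : (OnePoint ℂ ≃ₜ OnePoint ℂ) →* A)

lemma map_conj_eq (f g : OnePoint ℂ ≃ₜ OnePoint ℂ) : π (f * g * f⁻¹) = π g := by
  simp

lemma map_comm_eq (f g : OnePoint ℂ ≃ₜ OnePoint ℂ) : π (f * g * f⁻¹ * g⁻¹) = 1 := by
  simp

lemma map_scale (a : ℂˣ) : π (ptExt (aff a 0)) = 1 := by
  obtain ⟨m, hm⟩ : ∃ m : ℂ, m ^ 2 = a := IsAlgClosed.exists_pow_nat_eq _ two_pos
  have hm0 : m ≠ 0 := by rintro rfl; exact a.ne_zero (by simpa using hm.symm)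
  lift m to ℂˣ using hm0.isUnit
  have : ptExt (aff a 0) =
      ptExt (aff m 0) * inversion * (ptExt (aff m 0))⁻¹ * inversion⁻¹ := by
    ext x
    induction x with
    | infty => simp
    | coe z =>
      by_cases hz : z = 0
      · simp [hz]
      · simp [inversion_coe, hz, ← hm]; ring
  rw [this, map_comm_eq]

lemma map_translate (b : ℂ) : π (ptExt (aff 1 b)) = 1 := by
  have : aff 1 b = aff (Units.mk0 2 two_ne_zero) 0 * aff 1 b *
      (aff (Units.mk0 2 two_ne_zero) 0)⁻¹ * (aff 1 b)⁻¹ := by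
    ext z
    simp; ring
  rw [this]
  simp

lemma map_aff (a : ℂˣ) (b : ℂ) : π (ptExt (aff a b)) = 1 := by
  have : aff a b = aff 1 b * aff a 0 := by ext z; simp
  rw [this]
  simp [map_scale, map_translate]

lemma exists_moebius_to_infty (x : OnePoint ℂ) : ∃ m : OnePoint ℂ ≃ₜ OnePoint ℂ,
    π m = 1 ∧ m x = ∞ := by
  induction x with
  | infty => exact ⟨1, by simp⟩
  | coe z =>
    refine ⟨inversion * ptExt (aff 1 (-1)) * inversion⁻¹ * ptExt (aff 1 (1 - z)), ?_, ?_⟩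
    · rw [map_mul, map_conj_eq, map_aff, map_aff, one_mul]
    · simp [inversion_coe]

end Abelian
end SphereHomeo

namespace SphereHomeo
open OnePoint Filter Topology

/-- The infinite product of the translates by `3 k` of a map supported in the unit ball. -/
noncomputable def swindle (g : ℂ → ℂ) (z : ℂ) : ℂ := z + ∑ᶠ k : ℕ, (g (z - 3 * k) - (z - 3 * k))

lemma unique_translate {z : ℂ} {k j : ℕ} (hk : ‖z - 3 * k‖ < 1) (hj : ‖z - 3 * j‖ < 1) :
    j = k := by
  have h1 : ‖(3 * ((k : ℤ) - (j : ℤ) : ℤ) : ℂ)‖ < 2 := by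
    have : (3 * ((k : ℤ) - (j : ℤ) : ℤ) : ℂ) = (z - 3 * j) - (z - 3 * k) := by push_cast; ring
    rw [this]
    exact (norm_sub_le _ _).trans_lt (by linarith)
  rw [norm_mul, Complex.norm_intCast] at h1
  have h2 : |(((k : ℤ) - (j : ℤ) : ℤ) : ℝ)| < 1 := by
    have : ‖(3 : ℂ)‖ = 3 := by simp
    rw [this] at h1; linarith
  rw [← Int.cast_abs] at h2
  have h3 : |(k : ℤ) - j| < 1 := by exact_mod_cast h2
  rw [Int.abs_lt_one_iff] at h3
  omega

lemma swindle_of_lt {g : ℂ → ℂ} (hg : ∀ z, 1 ≤ ‖z‖ → g z = z) {z : ℂ} {k : ℕ}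
    (hk : ‖z - 3 * k‖ < 1) : swindle g z = g (z - 3 * k) + 3 * k := by
  rw [swindle, finsum_eq_single _ k]
  · ring
  · intro j hj
    rw [hg _ (not_lt.1 fun h ↦ hj (unique_translate hk h)), sub_self]

lemma swindle_of_forall {g : ℂ → ℂ} (hg : ∀ z, 1 ≤ ‖z‖ → g z = z) {z : ℂ}
    (hk : ∀ k : ℕ, 1 ≤ ‖z - 3 * k‖) : swindle g z = z := by
  rw [swindle, finsum_eq_zero_of_forall_eq_zero, add_zero]
  intro j
  rw [hg _ (hk j), sub_self]

lemma continuous_swindle {g : ℂ → ℂ} (hg : ∀ z, 1 ≤ ‖z‖ → g z = z) (hc : Continuous g) :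
    Continuous (swindle g) := by
  refine continuous_id.add (continuous_finsum (fun k ↦ by fun_prop) fun x ↦ ?_)
  refine ⟨Metric.ball x 1, Metric.ball_mem_nhds _ one_pos, ?_⟩
  refine (Set.finite_Iic (⌈‖x‖ + 2⌉₊)).subset ?_
  rintro k ⟨z, hz, hzx⟩
  have h1 : ‖z - 3 * k‖ < 1 := by
    by_contra h
    exact hz (by simp [hg _ (not_lt.1 h)])
  rw [mem_ball_iff_norm] at hzx
  have h2 : ‖(3 * k : ℂ)‖ ≤ ‖x‖ + 2 := by
    have : (3 * k : ℂ) = x + (z - x) - (z - 3 * k) := by ring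
    rw [this]
    refine (norm_sub_le _ _).trans ?_
    have := norm_add_le x (z - x)
    linarith
  have h3 : (k : ℝ) ≤ ‖x‖ + 2 := by
    simp at h2
    have : (0 : ℝ) ≤ k := k.cast_nonneg
    linarith
  exact_mod_cast h3.trans (Nat.le_ceil _)

lemma norm_lt_one_of_supported {g : ℂ ≃ₜ ℂ} (hg : ∀ z, 1 ≤ ‖z‖ → g z = z) {z : ℂ}
    (hz : ‖z‖ < 1) : ‖g z‖ < 1 := by
  by_contra h
  have := g.injective (hg _ (not_lt.1 h))
  rw [this] at h
  exact h hz

lemma supported_symm {g : ℂ ≃ₜ ℂ} (hg : ∀ z, 1 ≤ ‖z‖ → g z = z) :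
    ∀ z, 1 ≤ ‖z‖ → g.symm z = z := fun z hz ↦ by
  rw [Homeomorph.symm_apply_eq, hg z hz]

lemma swindle_swindle {g : ℂ ≃ₜ ℂ} (hg : ∀ z, 1 ≤ ‖z‖ → g z = z) (z : ℂ) :
    swindle g.symm (swindle g z) = z := by
  by_cases h : ∃ k : ℕ, ‖z - 3 * k‖ < 1
  · obtain ⟨k, hk⟩ := h
    have h1 := norm_lt_one_of_supported hg hk
    rw [swindle_of_lt hg hk, swindle_of_lt (supported_symm hg) (k := k) (by simpa using h1)]
    simp
  · push Not at h
    rw [swindle_of_forall hg h, swindle_of_forall (supported_symm hg) h]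

/-- The swindle as a homeomorphism. -/
noncomputable def swindleHomeo (g : ℂ ≃ₜ ℂ) (hg : ∀ z, 1 ≤ ‖z‖ → g z = z) : ℂ ≃ₜ ℂ where
  toFun := swindle g
  invFun := swindle g.symm
  left_inv := swindle_swindle hg
  right_inv := swindle_swindle (g := g.symm) (supported_symm hg)
  continuous_toFun := continuous_swindle hg g.continuous
  continuous_invFun := continuous_swindle (supported_symm hg) g.symm.continuous

lemma eq_commutator_of_supported (g : ℂ ≃ₜ ℂ) (hg : ∀ z, 1 ≤ ‖z‖ → g z = z) :
    ∃ F t : ℂ ≃ₜ ℂ, g = F * t * F⁻¹ * t⁻¹ := by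
  refine ⟨swindleHomeo g hg, aff 1 3, ?_⟩
  have : g * (aff 1 3 * swindleHomeo g hg * (aff 1 3)⁻¹) = swindleHomeo g hg := by
    ext z
    change g (1 * swindle g ((1⁻¹ : ℂˣ) * (z - 3)) + 3) = swindle g z
    simp only [inv_one, Units.val_one, one_mul]
    by_cases h : ∃ k : ℕ, ‖z - 3 * k‖ < 1
    · obtain ⟨k, hk⟩ := h
      rw [swindle_of_lt hg hk]
      have h1 := norm_lt_one_of_supported hg hk
      cases k with
      | zero =>
        rw [swindle_of_forall hg]
        · simp
        · intro k
          simp only [Nat.cast_zero, mul_zero, sub_zero] at hk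
          have h3 : ‖(3 * (k + 1) : ℂ)‖ = 3 * (k + 1) := by
            rw [norm_mul]
            norm_cast
          have : ‖(3 * (k + 1) : ℂ)‖ ≤ ‖z - 3 - 3 * k‖ + ‖z‖ := by
            have : (3 * (k + 1) : ℂ) = z - (z - 3 - 3 * k) := by ring
            rw [this]
            refine (norm_sub_le _ _).trans ?_
            rw [add_comm, sub_right_comm]
          have h4 : (0 : ℝ) ≤ k := k.cast_nonneg
          linarith
      | succ k =>
        rw [swindle_of_lt hg (k := k)]
        · push_cast at hk h1 ⊢
          have e : z - 3 - 3 * (k : ℂ) = z - 3 * (k + 1) := by ring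
          rw [e, hg]
          · ring
          · by_contra! h
            have := unique_translate (k := 0) (j := k + 1)
              (z := g (z - 3 * (k + 1)) + 3 * k + 3) (by simpa using h) (by
                push_cast
                rw [show g (z - 3 * (k + 1)) + 3 * k + 3 - 3 * ((k : ℂ) + 1)
                  = g (z - 3 * (k + 1)) by ring]
                exact h1)
            omega
        · push_cast at hk
          rwa [show z - 3 - 3 * (k : ℂ) = z - 3 * (k + 1) by ring]
    · push Not at h
      rw [swindle_of_forall hg h, swindle_of_forall hg, sub_add_cancel, hg]
      · simpa using h 0
      · intro k
        have := h (k + 1)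
        push_cast at this
        rwa [show z - 3 - 3 * (k : ℂ) = z - 3 * (k + 1) by ring]
  calc g = g * (aff 1 3 * swindleHomeo g hg * (aff 1 3)⁻¹)
      * (aff 1 3 * swindleHomeo g hg * (aff 1 3)⁻¹)⁻¹ := by group
    _ = _ := by rw [this]; group

section Abelian
variable {A : Type*} [CommGroup A] (π : (OnePoint ℂ ≃ₜ OnePoint ℂ) →* A)

lemma map_of_eqOn_ball (h : OnePoint ℂ ≃ₜ OnePoint ℂ) (a : ℂ) {r : ℝ} (hr : 0 < r)
    (hh : ∀ z ∈ Metric.ball a r, h (z : OnePoint ℂ) = z) : π h = 1 := by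
  set c : ℂˣ := Units.mk0 ((2 / r : ℝ) : ℂ) (by exact_mod_cast (by positivity)) with hc
  have hcc : (c : ℂ) = ((2 / r : ℝ) : ℂ) := rfl
  set m : OnePoint ℂ ≃ₜ OnePoint ℂ := inversion * ptExt (aff c 0) * ptExt (aff 1 (-a)) with hm
  have hm1 : m a = ∞ := by simp [hm, inversion_coe]
  have hms : ∀ x, m.symm x = (ptExt (aff 1 (-a))).symm ((ptExt (aff c 0)).symm (inversion x)) := by
    intro x
    rw [Homeomorph.symm_apply_eq]
    simp [hm, -ptExt_symm]
  have hm2 : m.symm ∞ = a := by rw [Homeomorph.symm_apply_eq, hm1]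
  obtain ⟨g, hg⟩ := exists_ptExt_eq (m * h * m⁻¹) (by
    simp [hm2, hh a (Metric.mem_ball_self hr), hm1])
  have hg1 : ∀ z, 1 ≤ ‖z‖ → g z = z := by
    intro z hz
    have hz0 : z ≠ 0 := by rintro rfl; norm_num at hz
    apply OnePoint.coe_injective
    rw [← ptExt_coe, hg]
    have h1 : m.symm z = (((c⁻¹ : ℂˣ) * z⁻¹ + a : ℂ) : OnePoint ℂ) := by
      rw [hms, inversion_coe_of_ne hz0]; simp
    have h2 : h (m.symm z) = m.symm z := by
      rw [h1]
      apply hh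
      rw [mem_ball_iff_norm, add_sub_cancel_right, norm_mul, Units.val_inv_eq_inv_val, hcc,
        norm_inv, norm_inv, Complex.norm_real, Real.norm_of_nonneg (by positivity), inv_div]
      have : ‖z‖⁻¹ ≤ 1 := inv_le_one_of_one_le₀ hz
      nlinarith
    simp [h2]
  obtain ⟨F, t, hF⟩ := eq_commutator_of_supported g hg1
  rw [← map_conj_eq π m h, ← hg, hF]
  simp

lemma map_ptExt_of_eqOn (g : ℂ ≃ₜ ℂ) {s : Set ℂ} (hs : (interior s).Nonempty)
    (hg : ∀ z ∈ s, g z = z) : π (ptExt g) = 1 := by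
  obtain ⟨a, ha⟩ := hs
  obtain ⟨r, hr, hrs⟩ := Metric.isOpen_iff.1 isOpen_interior a ha
  refine map_of_eqOn_ball π _ a hr fun z hz ↦ ?_
  rw [ptExt_coe, hg _ (interior_subset (hrs hz))]

end Abelian

lemma exists_glue {X : Type*} [TopologicalSpace X] (f : X ≃ₜ X) {s t : Set X} (hs : IsClosed s)
    (ht : IsClosed t) (hst : ∀ x, x ∈ s ∨ x ∈ t) (hf : ∀ x ∈ s, x ∈ t → f x = x)
    (hfs : ∀ x, f x ∈ s ↔ x ∈ s) :
    ∃ g : X ≃ₜ X, (∀ x ∈ s, g x = f x) ∧ ∀ x ∈ t, g x = x := by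
  classical
  have key : ∀ k : X ≃ₜ X, (∀ x ∈ s, x ∈ t → k x = x) →
      Continuous fun x ↦ if x ∈ s then k x else x := by
    intro k hk
    have h1 : ∀ x ∈ t, (if x ∈ s then k x else x) = x := by
      intro x hx
      split_ifs with h
      exacts [hk x h hx, rfl]
    have h2 : ContinuousOn (fun x ↦ if x ∈ s then k x else x) (s ∪ t) := by
      refine ContinuousOn.union_of_isClosed ?_ ?_ hs ht
      · exact k.continuous.continuousOn.congr fun x hx ↦ by simp [hx]
      · exact continuousOn_id.congr fun x hx ↦ by simp [h1 x hx]
    rwa [show s ∪ t = Set.univ from Set.eq_univ_of_forall hst, continuousOn_univ] at h2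
  have hfs' : ∀ x, f.symm x ∈ s ↔ x ∈ s := fun x ↦ by rw [← hfs, f.apply_symm_apply]
  refine ⟨⟨⟨fun x ↦ if x ∈ s then f x else x, fun x ↦ if x ∈ s then f.symm x else x, ?_, ?_⟩,
    key f hf, key f.symm ?_⟩, ?_, ?_⟩
  · intro x
    by_cases h : x ∈ s <;> simp [h, hfs]
  · intro x
    by_cases h : x ∈ s <;> simp [h, hfs']
  · intro x hx hx'
    rw [Homeomorph.symm_apply_eq, hf x hx hx']
  · intro x hx
    simp [hx]
  · intro x hx
    by_cases h : x ∈ s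
    · simp [h, hf x h hx]
    · simp [h]

lemma map_ptExt_of_glue {A : Type*} [CommGroup A] (π : (OnePoint ℂ ≃ₜ OnePoint ℂ) →* A)
    (f : ℂ ≃ₜ ℂ) {s t : Set ℂ} (hs : IsClosed s) (ht : IsClosed t)
    (hst : ∀ x, x ∈ s ∨ x ∈ t) (hf : ∀ x ∈ s, x ∈ t → f x = x) (hfs : ∀ x, f x ∈ s ↔ x ∈ s)
    (hs' : (interior s).Nonempty) (ht' : (interior t).Nonempty) : π (ptExt f) = 1 := by
  obtain ⟨g, hg1, hg2⟩ := exists_glue f hs ht hst hf hfs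
  have : f = g * (g⁻¹ * f) := by group
  rw [this, map_mul, map_mul, map_ptExt_of_eqOn π g ht' hg2, one_mul]
  refine map_ptExt_of_eqOn π _ hs' fun z hz ↦ ?_
  simp [← hg1 z hz]

end SphereHomeo

namespace SphereHomeo
open OnePoint Filter Topology

/-- The homeomorphism `x + i y ↦ f x + i y`. -/
noncomputable def reMap (f : ℝ ≃ₜ ℝ) : ℂ ≃ₜ ℂ where
  toFun z := ⟨f z.re, z.im⟩
  invFun z := ⟨f.symm z.re, z.im⟩
  left_inv z := by simp
  right_inv z := by simp
  continuous_toFun := by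
    have : (fun z : ℂ ↦ (⟨f z.re, z.im⟩ : ℂ)) = fun z ↦ (f z.re : ℂ) + z.im * Complex.I := by
      ext z; exact Complex.mk_eq_add_mul_I _ _
    rw [this]
    have := f.continuous
    fun_prop
  continuous_invFun := by
    have : (fun z : ℂ ↦ (⟨f.symm z.re, z.im⟩ : ℂ)) =
        fun z ↦ (f.symm z.re : ℂ) + z.im * Complex.I := by
      ext z; exact Complex.mk_eq_add_mul_I _ _
    rw [this]
    have := f.symm.continuous
    fun_prop

@[simp] lemma reMap_re (f : ℝ ≃ₜ ℝ) (z : ℂ) : (reMap f z).re = f z.re := rfl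
@[simp] lemma reMap_im (f : ℝ ≃ₜ ℝ) (z : ℂ) : (reMap f z).im = z.im := rfl
@[simp] lemma reMap_symm_re (f : ℝ ≃ₜ ℝ) (z : ℂ) : ((reMap f).symm z).re = f.symm z.re := rfl
@[simp] lemma reMap_symm_im (f : ℝ ≃ₜ ℝ) (z : ℂ) : ((reMap f).symm z).im = z.im := rfl

lemma interior_nonempty_of_lt {φ : ℂ → ℝ} (hφ : Continuous φ) {z : ℂ} (hz : 0 < φ z) :
    (interior {z | 0 ≤ φ z}).Nonempty := by
  refine ⟨z, mem_interior.2 ⟨{z | 0 < φ z}, fun w hw ↦ ?_, isOpen_lt continuous_const hφ, hz⟩⟩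
  exact le_of_lt (α := ℝ) hw

variable {A : Type*} [CommGroup A] (π : (OnePoint ℂ ≃ₜ OnePoint ℂ) →* A)

lemma map_ptExt_of_glue_fun (f : ℂ ≃ₜ ℂ) {φ : ℂ → ℝ} (hφ : Continuous φ) (z w : ℂ) (hz : 0 < φ z)
    (hw : φ w < 0) (hf : ∀ z, φ z = 0 → f z = z) (hfs : ∀ z, 0 ≤ φ (f z) ↔ 0 ≤ φ z) :
    π (ptExt f) = 1 := by
  refine map_ptExt_of_glue π f (s := {z | 0 ≤ φ z}) (t := {z | 0 ≤ - φ z})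
    (isClosed_le continuous_const hφ) (isClosed_le continuous_const hφ.neg) (fun x ↦ ?_)
    (fun x hx hx' ↦ ?_) hfs (interior_nonempty_of_lt hφ hz)
    (interior_nonempty_of_lt hφ.neg (z := w) (by linarith))
  · rcases le_total 0 (φ x) with h | h
    · exact Or.inl h
    · exact Or.inr (neg_nonneg.2 h)
  · simp only [Set.mem_ofPred_eq] at hx hx'
    exact hf x (by linarith)

lemma map_reMap (f : ℝ ≃ₜ ℝ) (hf : StrictMono f) : π (ptExt (reMap f)) = 1 := by
  set b : ℂ := ((-f 0 : ℝ) : ℂ)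
  have h1 : π (ptExt (aff 1 b * reMap f)) = 1 := by
    refine map_ptExt_of_glue_fun π _ Complex.continuous_re 1 (-1) (by simp) (by simp)
      (fun z hz ↦ ?_) fun z ↦ ?_
    · apply Complex.ext <;> simp [b, hz]
    · simp [b, hf.le_iff_le]
  rwa [map_mul, map_mul, map_aff, one_mul] at h1

lemma map_of_preserves_upper (V : ℂ ≃ₜ ℂ) (h0 : ∀ z, (V z).im = 0 ↔ z.im = 0)
    (h1 : ∀ z, 0 ≤ (V z).im ↔ 0 ≤ z.im) :
    π (ptExt V) = 1 ∨ π (ptExt V) = π (ptExt conjHomeo) := by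
  have mono_case : ∀ V : ℂ ≃ₜ ℂ, (∀ z, (V z).im = 0 ↔ z.im = 0) →
      (∀ z, 0 ≤ (V z).im ↔ 0 ≤ z.im) → StrictMono (fun x : ℝ ↦ (V x).re) →
      π (ptExt V) = 1 := by
    intro V h0 h1 hm
    have hr : ∀ x : ℝ, V x = ((V x).re : ℂ) := fun x ↦
      Complex.ext (by simp) (by simp [h0])
    have hs : Function.Surjective (fun x : ℝ ↦ (V x).re) := by
      intro y
      have : (V.symm y).im = 0 := by rw [← h0]; simp
      refine ⟨(V.symm y).re, ?_⟩
      have e : (((V.symm y).re : ℝ) : ℂ) = V.symm y := Complex.ext (by simp) (by simp [this])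
      simp [e]
    let f : ℝ ≃ₜ ℝ := (hm.orderIsoOfSurjective _ hs).toHomeomorph
    have hf : ∀ x : ℝ, f x = (V x).re := fun x ↦ rfl
    have h2 : π (ptExt ((reMap f)⁻¹ * V)) = 1 := by
      refine map_ptExt_of_glue_fun π _ Complex.continuous_im Complex.I (-Complex.I) (by simp)
        (by simp) (fun z hz ↦ ?_) fun z ↦ ?_
      · obtain ⟨x, rfl⟩ : ∃ x : ℝ, z = x := ⟨z.re, Complex.ext (by simp) (by simp [hz])⟩
        simp only [Homeomorph.mul_apply, Homeomorph.inv_apply]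
        rw [Homeomorph.symm_apply_eq, hr]
        exact Complex.ext (by simp [hf]) (by simp)
      · simp [h1]
    rwa [map_mul, map_mul, map_inv, map_inv, map_reMap π f hm, inv_one, one_mul] at h2
  have hc : Continuous fun x : ℝ ↦ (V x).re := by
    have := V.continuous
    fun_prop
  have hi : Function.Injective fun x : ℝ ↦ (V x).re := by
    intro x y hxy
    have : V x = V y := Complex.ext hxy (by rw [(h0 x).2 (by simp), (h0 y).2 (by simp)])
    exact_mod_cast V.injective this
  rcases hc.strictMono_of_inj hi with hm | hm
  · exact Or.inl (mono_case V h0 h1 hm)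
  · right
    have h2 : π (ptExt (aff (-1) 0 * conjHomeo * V)) = 1 := by
      refine mono_case _ (by simp [h0]) (by simp [h1]) ?_
      intro x y hxy
      simpa using hm hxy
    rw [map_mul, map_mul, map_mul, map_mul, map_aff, one_mul] at h2
    have h3 : π (ptExt conjHomeo) * π (ptExt conjHomeo) = 1 := by
      rw [← map_mul, ← map_mul, show conjHomeo * conjHomeo = 1 by ext z; simp, map_one, map_one]
    rw [← mul_right_inj (π (ptExt conjHomeo)), h2, h3]

end SphereHomeo

namespace SphereHomeo
open OnePoint Filter Topology

/-- A radial cutoff function, equal to `1` on the ball of radius `s` and to `0` outside of the ball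
of radius `2 s`. -/
noncomputable def cutoff (s : ℝ) (z : ℂ) : ℝ := max 0 (min 1 (2 - ‖z‖ / s))

lemma cutoff_nonneg (s : ℝ) (z : ℂ) : 0 ≤ cutoff s z := le_max_left _ _

lemma cutoff_le_one (s : ℝ) (z : ℂ) : cutoff s z ≤ 1 := max_le zero_le_one (min_le_left _ _)

lemma cutoff_eq_one {s : ℝ} (hs : 0 < s) {z : ℂ} (hz : ‖z‖ ≤ s) : cutoff s z = 1 := by
  have : ‖z‖ / s ≤ 1 := (div_le_one hs).2 hz
  rw [cutoff, min_eq_left (by linarith), max_eq_right zero_le_one]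

lemma cutoff_eq_zero {s : ℝ} (hs : 0 < s) {z : ℂ} (hz : 2 * s ≤ ‖z‖) : cutoff s z = 0 := by
  have : 2 ≤ ‖z‖ / s := (le_div_iff₀ hs).2 hz
  rw [cutoff, max_eq_left (min_le_of_right_le (by linarith))]

lemma abs_cutoff_sub_le {s : ℝ} (hs : 0 < s) (z w : ℂ) :
    |cutoff s z - cutoff s w| ≤ ‖z - w‖ / s := by
  have h1 : |cutoff s z - cutoff s w| ≤ |min 1 (2 - ‖z‖ / s) - min 1 (2 - ‖w‖ / s)| := by
    have := abs_max_sub_max_le_max 0 (min 1 (2 - ‖z‖ / s)) 0 (min 1 (2 - ‖w‖ / s))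
    simpa [cutoff] using this
  have h2 := abs_min_sub_min_le_max 1 (2 - ‖z‖ / s) 1 (2 - ‖w‖ / s)
  have h3 : |(2 - ‖z‖ / s) - (2 - ‖w‖ / s)| ≤ ‖z - w‖ / s := by
    rw [show (2 - ‖z‖ / s) - (2 - ‖w‖ / s) = (‖w‖ - ‖z‖) / s by ring, abs_div, abs_of_pos hs,
      norm_sub_rev]
    gcongr
    exact abs_norm_sub_norm_le w z
  refine h1.trans (h2.trans (max_le ?_ h3))
  simp
  positivity

lemma lipschitz_cutoff_mul {d : ℂ → ℂ} {r : ℝ} (hr : 0 < r) (hd0 : d 0 = 0)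
    (hd : LipschitzOnWith (1 / 6) d (Metric.ball 0 r)) :
    LipschitzWith (1 / 2) fun z ↦ (cutoff (r / 3) z : ℂ) * d z := by
  have hr3 : 0 < r / 3 := by positivity
  have main : ∀ z w : ℂ, ‖z‖ ≤ ‖w‖ → ‖(cutoff (r / 3) z : ℂ) * d z - (cutoff (r / 3) w : ℂ) * d w‖
      ≤ 1 / 2 * ‖z - w‖ := by
    intro z w hzw
    rcases le_or_gt (2 * (r / 3)) ‖z‖ with hz | hz
    · rw [cutoff_eq_zero hr3 hz, cutoff_eq_zero hr3 (hz.trans hzw)]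
      simp
    have hzb : z ∈ Metric.ball (0 : ℂ) r := by rw [mem_ball_zero_iff]; linarith
    have h0b : (0 : ℂ) ∈ Metric.ball (0 : ℂ) r := Metric.mem_ball_self hr
    have hdz : ‖d z‖ ≤ 1 / 6 * ‖z‖ := by
      have := hd.dist_le_mul z hzb 0 h0b
      simpa [hd0] using this
    have e : (cutoff (r / 3) z : ℂ) * d z - (cutoff (r / 3) w : ℂ) * d w =
        cutoff (r / 3) w * (d z - d w) + ((cutoff (r / 3) z - cutoff (r / 3) w : ℝ) : ℂ) * d z := by
      push_cast; ring
    rw [e]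
    refine (norm_add_le _ _).trans ?_
    have t1 : ‖(cutoff (r / 3) w : ℂ) * (d z - d w)‖ ≤ 1 / 6 * ‖z - w‖ := by
      rcases le_or_gt (2 * (r / 3)) ‖w‖ with hw | hw
      · rw [cutoff_eq_zero hr3 hw]; simp
      · have hwb : w ∈ Metric.ball (0 : ℂ) r := by rw [mem_ball_zero_iff]; linarith
        have := hd.dist_le_mul z hzb w hwb
        rw [dist_eq_norm, dist_eq_norm] at this
        rw [norm_mul, Complex.norm_real, Real.norm_of_nonneg (cutoff_nonneg _ _)]
        have h6 : ((1 / 6 : NNReal) : ℝ) = 1 / 6 := by simp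
        rw [h6] at this
        have := mul_le_mul (cutoff_le_one (r / 3) w) this (norm_nonneg _) zero_le_one
        linarith
    have t2 : ‖((cutoff (r / 3) z - cutoff (r / 3) w : ℝ) : ℂ) * d z‖ ≤ 1 / 3 * ‖z - w‖ := by
      rw [norm_mul, Complex.norm_real, Real.norm_eq_abs]
      calc _ ≤ ‖z - w‖ / (r / 3) * (1 / 6 * (2 * (r / 3))) := by
            gcongr
            · exact abs_cutoff_sub_le hr3 z w
            · exact hdz.trans (by gcongr)
        _ = _ := by field_simp; ring
    linarith
  refine LipschitzWith.of_dist_le_mul fun z w ↦ ?_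
  have h2 : ((1 / 2 : NNReal) : ℝ) = 1 / 2 := by simp
  rw [h2, dist_eq_norm, dist_eq_norm]
  rcases le_total ‖z‖ ‖w‖ with h | h
  · exact main z w h
  · rw [norm_sub_rev, norm_sub_rev z w]
    exact main w z h

lemma exists_homeo_of_lipschitz_half {e : ℂ → ℂ} (he : LipschitzWith (1 / 2) e) :
    ∃ g : ℂ ≃ₜ ℂ, ∀ z, g z = z + e z := by
  have h : ApproximatesLinearOn (fun z ↦ z + e z)
      ((ContinuousLinearEquiv.refl ℂ ℂ : ℂ ≃L[ℂ] ℂ) : ℂ →L[ℂ] ℂ) Set.univ (1 / 2) := by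
    rw [ApproximatesLinearOn.approximatesLinearOn_iff_lipschitzOnWith]
    have : (fun z ↦ z + e z) - ⇑((ContinuousLinearEquiv.refl ℂ ℂ : ℂ ≃L[ℂ] ℂ) : ℂ →L[ℂ] ℂ) = e := by
      ext z; simp
    rw [this]
    exact he.lipschitzOnWith
  refine ⟨h.toHomeomorph _ (Or.inr ?_), fun z ↦ rfl⟩
  have : ‖((ContinuousLinearEquiv.refl ℂ ℂ).symm : ℂ →L[ℂ] ℂ)‖₊ = 1 := by
    have : ((ContinuousLinearEquiv.refl ℂ ℂ).symm : ℂ →L[ℂ] ℂ) = ContinuousLinearMap.id ℂ ℂ := rfl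
    rw [this]
    exact ContinuousLinearMap.nnnorm_id
  rw [this]
  rw [inv_one, ← NNReal.coe_lt_coe]
  norm_num

variable {A : Type*} [CommGroup A] (π : (OnePoint ℂ ≃ₜ OnePoint ℂ) →* A)

lemma map_of_hasStrictDerivAt_one (Φ : ℂ ≃ₜ ℂ) (h0 : Φ 0 = 0) (h : HasStrictDerivAt Φ 1 0) :
    π (ptExt Φ) = 1 := by
  have hd : HasStrictDerivAt (fun z ↦ Φ z - z) 0 0 := by
    have := h.sub (hasStrictDerivAt_id 0)
    rw [sub_self] at this
    exact this
  obtain ⟨s, hs, hL⟩ := hd.hasStrictFDerivAt.exists_lipschitzOnWith_of_nnnorm_lt (1 / 6) (by simp)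
  obtain ⟨r, hr, hrs⟩ := Metric.mem_nhds_iff.1 hs
  obtain ⟨g, hg⟩ := exists_homeo_of_lipschitz_half
    (lipschitz_cutoff_mul hr (by simp [h0]) (hL.mono hrs))
  have hr3 : 0 < r / 3 := by positivity
  have : Φ = g * (g⁻¹ * Φ) := by group
  rw [this, map_mul, map_mul]
  have e1 : π (ptExt g) = 1 := by
    refine map_ptExt_of_eqOn π g (s := {z | 0 ≤ ‖z‖ - 2 * (r / 3)})
      (interior_nonempty_of_lt (by fun_prop) (z := r) ?_) fun z hz ↦ ?_
    · rw [Complex.norm_real, Real.norm_of_nonneg hr.le]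
      linarith
    · rw [hg, cutoff_eq_zero hr3 (by simpa using hz)]
      simp
  have e2 : π (ptExt (g⁻¹ * Φ)) = 1 := by
    refine map_ptExt_of_eqOn π _ (s := Metric.ball 0 (r / 3)) ?_ fun z hz ↦ ?_
    · rw [Metric.isOpen_ball.interior_eq]
      exact Metric.nonempty_ball.2 hr3
    · rw [Homeomorph.mul_apply, Homeomorph.inv_apply, Homeomorph.symm_apply_eq, hg,
        cutoff_eq_one hr3 (mem_ball_zero_iff.1 hz).le]
      simp
  rw [e1, e2, one_mul]

lemma map_of_hasStrictDerivAt (Φ : ℂ ≃ₜ ℂ) {a : ℂ} (ha : a ≠ 0) (h : HasStrictDerivAt Φ a 0) :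
    π (ptExt Φ) = 1 := by
  lift a to ℂˣ using ha.isUnit
  have := map_of_hasStrictDerivAt_one π (aff a⁻¹ (-((a⁻¹ : ℂˣ) * Φ 0)) * Φ) (by simp) (by
    have := (h.const_mul ((a⁻¹ : ℂˣ) : ℂ)).add_const (-((a⁻¹ : ℂˣ) * Φ 0))
    rw [Units.inv_mul] at this
    exact this)
  rwa [map_mul, map_mul, map_aff, one_mul] at this

end SphereHomeo

namespace SphereHomeo
open OnePoint Filter Topology
open Metric (ball closedBall sphere)

lemma exists_tendstoLocallyUniformlyOn {U : Set ℂ} (hU : IsOpen U) (f : ℕ → ℂ → ℂ)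
    (hd : ∀ n, DifferentiableOn ℂ (f n) U) (hm : ∀ n, Set.MapsTo (f n) U (ball 0 1)) :
    ∃ F : ℂ → ℂ, TendstoLocallyUniformlyOn f F (hyperfilter ℕ : Filter ℕ) U := by
  have key : ∀ z, ∃ y, z ∈ U → Tendsto (fun n ↦ f n z) (hyperfilter ℕ : Filter ℕ) (𝓝 y) := by
    intro z
    by_cases hz : z ∈ U
    · obtain ⟨y, -, hy⟩ := (isCompact_closedBall (0 : ℂ) 1).ultrafilter_le_nhds'
        ((hyperfilter ℕ).map fun n ↦ f n z)
        (Ultrafilter.mem_map.2 <| Filter.univ_mem' fun n ↦ Metric.ball_subset_closedBall (hm n hz))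
      exact ⟨y, fun _ ↦ hy⟩
    · exact ⟨0, fun h ↦ absurd h hz⟩
  choose F hF using key
  refine ⟨F, Metric.tendstoLocallyUniformlyOn_iff.2 fun ε hε x hx ↦ ?_⟩
  obtain ⟨r, hr, hrU⟩ := Metric.isOpen_iff.1 hU x hx
  have hL : ∀ n, ∀ y ∈ ball x r, dist (f n y) (f n x) ≤ 2 / r * dist y x := by
    intro n y hy
    refine Complex.dist_le_div_mul_dist_of_mapsTo_ball ((hd n).mono hrU) (fun w hw ↦ ?_) hy
    have h1 := mem_ball_zero_iff.1 (hm n (hrU hw))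
    have h2 := mem_ball_zero_iff.1 (hm n hx)
    rw [mem_closedBall_iff_norm]
    linarith [norm_sub_le (f n w) (f n x)]
  have hLF : ∀ y ∈ ball x r, dist (F y) (F x) ≤ 2 / r * dist y x := fun y hy ↦
    le_of_tendsto ((hF y (hrU hy)).dist (hF x hx)) (.of_forall fun n ↦ hL n y hy)
  refine ⟨ball x (min r (ε * r / 8)), mem_nhdsWithin_of_mem_nhds
    (Metric.ball_mem_nhds _ (by positivity)), ?_⟩
  filter_upwards [Metric.tendsto_nhds.1 (hF x hx) (ε / 4) (by positivity)] with n hn y hy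
  have hy1 : y ∈ ball x r := Metric.ball_subset_ball (min_le_left _ _) hy
  have hy2 : dist y x < ε * r / 8 := (Metric.mem_ball.1 hy).trans_le (min_le_right _ _)
  have h3 : 2 / r * dist y x ≤ 2 / r * (ε * r / 8) := by gcongr
  have h4 : 2 / r * (ε * r / 8) = ε / 4 := by field_simp; ring
  have h5 := dist_triangle4 (F y) (F x) (f n x) (f n y)
  rw [dist_comm (F x), dist_comm (f n x) (f n y)] at h5
  linarith [hL n y hy1, hLF y hy1]

lemma injOn_of_tendstoLocallyUniformlyOn {U : Set ℂ} (hU : IsOpen U) (hUc : IsPreconnected U)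
    {l : Filter ℕ} [l.NeBot] {f : ℕ → ℂ → ℂ} {F : ℂ → ℂ}
    (hd : ∀ n, DifferentiableOn ℂ (f n) U) (hi : ∀ n, Set.InjOn (f n) U)
    (hF : TendstoLocallyUniformlyOn f F l U) {p : ℂ} (hp : p ∈ U) (hFp : deriv F p ≠ 0) :
    Set.InjOn F U := by
  intro a ha b hb hab
  by_contra hne
  have hdF : DifferentiableOn ℂ F U := hF.differentiableOn (.of_forall hd) hU
  have han : AnalyticOnNhd ℂ (fun z ↦ F z - F a) U :=
    (hdF.sub_const (F a)).analyticOnNhd hU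
  have hev : ∀ᶠ z in 𝓝[≠] b, F z - F a ≠ 0 := by
    by_contra hcon
    have h0 := han.eqOn_zero_of_preconnected_of_frequently_eq_zero hUc hb
      hcon
    apply hFp
    have : F =ᶠ[𝓝 p] fun _ ↦ F a := by
      filter_upwards [hU.mem_nhds hp] with z hz
      exact sub_eq_zero.1 (h0 hz)
    rw [this.deriv_eq, deriv_const]
  have hV : U \ {a} ∈ 𝓝 b := (hU.sdiff isClosed_singleton).mem_nhds ⟨hb, Ne.symm hne⟩
  obtain ⟨r, hr, hrs⟩ := Metric.nhds_basis_closedBall.mem_iff.1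
    (Filter.inter_mem hV (eventually_nhdsWithin_iff.1 hev))
  have hsph : ∀ z ∈ sphere b r, F z - F a ≠ 0 := fun z hz ↦
    (hrs (Metric.sphere_subset_closedBall hz)).2 (Metric.ne_of_mem_sphere hz hr.ne')
  have hbU : closedBall b r ⊆ U := fun z hz ↦ (hrs hz).1.1
  have hcont : ContinuousOn F U := hdF.continuousOn
  obtain ⟨z0, hz0, hmin⟩ := (isCompact_sphere b r).exists_isMinOn
    (NormedSpace.sphere_nonempty.2 hr.le)
    (((hcont.sub continuousOn_const).norm).mono (Metric.sphere_subset_closedBall.trans hbU) :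
      ContinuousOn (fun z ↦ ‖F z - F a‖) (sphere b r))
  set m := ‖F z0 - F a‖ with hm
  have hm0 : 0 < m := norm_pos_iff.2 (hsph z0 hz0)
  have hu := (tendstoLocallyUniformlyOn_iff_forall_isCompact hU).1 hF _ hbU
    (isCompact_closedBall b r)
  have hu' := Metric.tendstoUniformlyOn_iff.1 hu (m / 4) (by positivity)
  have hua := Metric.tendsto_nhds.1 (hF.tendsto_at ha) (m / 4) (by positivity)
  obtain ⟨n, hn1, hn2⟩ := (hu'.and hua).exists
  have hcl : ∀ z ∈ closedBall b r, ‖(f n z - f n a) - (F z - F a)‖ < m / 2 := by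
    intro z hz
    have h1 := hn1 z hz
    rw [dist_comm, dist_eq_norm] at h1
    rw [dist_eq_norm] at hn2
    calc _ = ‖(f n z - F z) - (f n a - F a)‖ := by congr 1; ring
      _ ≤ _ := norm_sub_le _ _
      _ < m / 2 := by linarith
  have hb1 : ‖f n b - f n a‖ < m / 2 := by
    simpa [hab] using hcl b (Metric.mem_closedBall_self hr.le)
  have hnz : ∀ z ∈ closedBall b r, f n z - f n a ≠ 0 := fun z hz h ↦
    (hrs hz).1.2 (hi n (hbU hz) ha (sub_eq_zero.1 h))
  have hdc : DiffContOnCl ℂ (fun z ↦ (f n z - f n a)⁻¹) (ball b r) := by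
    refine DifferentiableOn.diffContOnCl ?_
    rw [closure_ball _ hr.ne']
    exact (((hd n).mono hbU).sub_const _).inv hnz
  have hmax := Complex.norm_le_of_forall_mem_frontier_norm_le Metric.isBounded_ball hdc
    (C := 2 / m) (fun z hz ↦ by
      rw [frontier_ball _ hr.ne'] at hz
      have h1 := hcl z (Metric.sphere_subset_closedBall hz)
      have h2 : m ≤ ‖F z - F a‖ := hmin hz
      have h3 : m / 2 ≤ ‖f n z - f n a‖ := by
        have := norm_sub_norm_le (F z - F a) (f n z - f n a)
        rw [norm_sub_rev] at h1
        linarith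
      rw [norm_inv]
      calc _ ≤ (m / 2)⁻¹ := inv_anti₀ (by positivity) h3
        _ = 2 / m := by rw [inv_div])
    (subset_closure (Metric.mem_ball_self hr))
  rw [norm_inv] at hmax
  have h6 : 0 < ‖f n b - f n a‖ := norm_pos_iff.2 (hnz b (Metric.mem_closedBall_self hr.le))
  have h7 : m / 2 ≤ ‖f n b - f n a‖ := by
    rw [inv_le_comm₀ h6 (by positivity), inv_div] at hmax
    exact hmax
  linarith

end SphereHomeo

namespace SphereHomeo
open OnePoint Filter Topology
open Metric (ball closedBall sphere)
open scoped ComplexConjugate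

/-- The automorphism of the unit disc sending `w` to `0`. -/
noncomputable def discShift (w z : ℂ) : ℂ := (z - w) / (1 - conj w * z)

lemma discShift_self (w : ℂ) : discShift w w = 0 := by simp [discShift]

lemma one_sub_conj_mul_ne_zero {w z : ℂ} (hw : ‖w‖ < 1) (hz : ‖z‖ < 1) : 1 - conj w * z ≠ 0 := by
  intro h
  have h1 : ‖conj w * z‖ = 1 := by rw [← sub_eq_zero.1 h, norm_one]
  rw [norm_mul, Complex.norm_conj] at h1
  nlinarith [norm_nonneg w, norm_nonneg z]

lemma discShift_eq_zero {w z : ℂ} (hw : ‖w‖ < 1) (hz : ‖z‖ < 1) : discShift w z = 0 ↔ z = w := by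
  rw [discShift, div_eq_zero_iff, or_iff_left (one_sub_conj_mul_ne_zero hw hz), sub_eq_zero]

lemma norm_discShift_lt_one {w z : ℂ} (hw : ‖w‖ < 1) (hz : ‖z‖ < 1) : ‖discShift w z‖ < 1 := by
  rw [discShift, norm_div, div_lt_one (norm_pos_iff.2 (one_sub_conj_mul_ne_zero hw hz)),
    ← sq_lt_sq₀ (norm_nonneg _) (norm_nonneg _), ← Complex.normSq_eq_norm_sq,
    ← Complex.normSq_eq_norm_sq]
  have h1 : Complex.normSq w < 1 := by
    rw [Complex.normSq_eq_norm_sq]; nlinarith [norm_nonneg w]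
  have h2 : Complex.normSq z < 1 := by
    rw [Complex.normSq_eq_norm_sq]; nlinarith [norm_nonneg z]
  have h3 : Complex.normSq (1 - conj w * z) - Complex.normSq (z - w)
      = (1 - Complex.normSq z) * (1 - Complex.normSq w) := by
    simp only [Complex.normSq_apply, Complex.sub_re, Complex.sub_im, Complex.mul_re,
      Complex.mul_im, Complex.conj_re, Complex.conj_im, Complex.one_re, Complex.one_im]
    ring
  nlinarith

lemma discShift_inj {w z z' : ℂ} (hw : ‖w‖ < 1) (hz : ‖z‖ < 1) (hz' : ‖z'‖ < 1)
    (h : discShift w z = discShift w z') : z = z' := by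
  rw [discShift, discShift, div_eq_div_iff (one_sub_conj_mul_ne_zero hw hz)
    (one_sub_conj_mul_ne_zero hw hz')] at h
  have h1 : (z - z') * (1 - conj w * w) = 0 := by linear_combination h
  rw [mul_eq_zero, or_iff_left (one_sub_conj_mul_ne_zero hw hw), sub_eq_zero] at h1
  exact h1

lemma hasDerivAt_discShift {w z : ℂ} (hw : ‖w‖ < 1) (hz : ‖z‖ < 1) :
    HasDerivAt (discShift w) ((1 - conj w * w) / (1 - conj w * z) ^ 2) z := by
  have h := ((hasDerivAt_id z).sub_const w).fun_div
    (((hasDerivAt_id z).const_mul (conj w)).const_sub 1) (one_sub_conj_mul_ne_zero hw hz)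
  refine h.congr_deriv ?_
  simp only [id]
  congr 1
  ring

/-- The square root trick: an injective holomorphic map to the disc that is not onto can be
improved. -/
lemma exists_deriv_lt_of_notMem_image {U : Set ℂ} (hU : IsOpen U) (hUs : IsSimplyConnected U)
    {F : ℂ → ℂ} (hd : DifferentiableOn ℂ F U) (hi : Set.InjOn F U)
    (hm : Set.MapsTo F U (ball 0 1)) {p : ℂ} (hp : p ∈ U) (hFp : F p = 0) (hF' : deriv F p ≠ 0)
    {w : ℂ} (hw : w ∈ ball (0 : ℂ) 1) (hwF : w ∉ F '' U) :
    ∃ k : ℂ → ℂ, DifferentiableOn ℂ k U ∧ Set.InjOn k U ∧ Set.MapsTo k U (ball 0 1) ∧ k p = 0 ∧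
      ‖deriv F p‖ < ‖deriv k p‖ := by
  have hm' : ∀ z ∈ U, ‖F z‖ < 1 := fun z hz ↦ mem_ball_zero_iff.1 (hm hz)
  rw [mem_ball_zero_iff] at hw
  set g : ℂ → ℂ := fun z ↦ discShift w (F z) with hg
  have hg' : ∀ z ∈ U, HasDerivAt g
      ((1 - conj w * w) / (1 - conj w * F z) ^ 2 * deriv F z) z := fun z hz ↦
    (hasDerivAt_discShift hw (hm' z hz)).comp z
      (hd.differentiableAt (hU.mem_nhds hz)).hasDerivAt
  have hg0 : (0 : ℂ) ∉ g '' U := by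
    rintro ⟨z, hz, h⟩
    exact hwF ⟨z, hz, (discShift_eq_zero hw (hm' z hz)).1 h⟩
  obtain ⟨h, hc, hsq⟩ := Complex.exists_continuousOn_pow_eq hUs hU (g := g)
    (fun z hz ↦ (hg' z hz).continuousAt.continuousWithinAt) hg0 two_ne_zero
  have hh1 : ∀ z ∈ U, ‖h z‖ < 1 := by
    intro z hz
    have h1 : ‖g z‖ < 1 := norm_discShift_lt_one hw (hm' z hz)
    rw [← hsq z, norm_pow] at h1
    exact (pow_lt_one_iff_of_nonneg (norm_nonneg _) two_ne_zero).1 h1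
  have hh0 : ∀ z ∈ U, h z ≠ 0 := fun z hz h0 ↦ hg0 ⟨z, hz, by rw [← hsq z, h0]; simp⟩
  have hh' : ∀ z ∈ U, HasDerivAt h
      ((1 - conj w * w) / (1 - conj w * F z) ^ 2 * deriv F z / (2 * h z)) z := by
    intro z hz
    rw [hasDerivAt_iff_tendsto_slope]
    have e : ∀ᶠ y in 𝓝[≠] z, slope g z y / (h y + h z) = slope h z y := by
      have hcz : Tendsto (fun y ↦ h y + h z) (𝓝 z) (𝓝 (h z + h z)) :=
        ((hc.continuousAt (hU.mem_nhds hz)).add_const _)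
      have : h z + h z ≠ 0 := by rw [← two_mul]; simp [hh0 z hz]
      filter_upwards [self_mem_nhdsWithin, mem_nhdsWithin_of_mem_nhds
        (hcz.eventually_ne this)] with y hy1 hy2
      rw [slope_def_field, slope_def_field, ← hsq, ← hsq, div_right_comm, sq_sub_sq, mul_comm,
        mul_div_cancel_right₀ _ hy2]
    refine Tendsto.congr' e ?_
    refine ((hasDerivAt_iff_tendsto_slope.1 (hg' z hz))).div ?_ (by simp [hh0 z hz])
    rw [two_mul]
    exact tendsto_nhdsWithin_of_tendsto_nhds ((hc.continuousAt (hU.mem_nhds hz)).add_const _)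
  have hk' : ∀ z ∈ U, HasDerivAt (fun z ↦ discShift (h p) (h z))
      ((1 - conj (h p) * h p) / (1 - conj (h p) * h z) ^ 2 *
        ((1 - conj w * w) / (1 - conj w * F z) ^ 2 * deriv F z / (2 * h z))) z := fun z hz ↦
    (hasDerivAt_discShift (hh1 p hp) (hh1 z hz)).comp z (hh' z hz)
  refine ⟨fun z ↦ discShift (h p) (h z), fun z hz ↦
    (hk' z hz).differentiableAt.differentiableWithinAt, fun z hz z' hz' hzz ↦ ?_, fun z hz ↦ ?_,
    discShift_self _, ?_⟩
  · have := discShift_inj (hh1 p hp) (hh1 z hz) (hh1 z' hz') hzz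
    have h2 : g z = g z' := by rw [← hsq, ← hsq, this]
    exact hi hz hz' (discShift_inj hw (hm' z hz) (hm' z' hz') h2)
  · exact mem_ball_zero_iff.2 (norm_discShift_lt_one (hh1 p hp) (hh1 z hz))
  · rw [(hk' p hp).deriv, hFp]
    set s := ‖h p‖ with hs
    have hs0 : 0 < s := norm_pos_iff.2 (hh0 p hp)
    have hs1 : s < 1 := hh1 p hp
    have hws : ‖w‖ = s ^ 2 := by
      rw [hs, ← norm_pow, hsq, hg]
      simp [discShift, hFp]
    have e1 : (1 - conj (h p) * h p) = ((1 - s ^ 2 : ℝ) : ℂ) := by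
      rw [mul_comm, Complex.mul_conj, Complex.normSq_eq_norm_sq]; push_cast; rfl
    have e2 : (1 - conj w * w) = ((1 - s ^ 4 : ℝ) : ℂ) := by
      rw [mul_comm, Complex.mul_conj, Complex.normSq_eq_norm_sq, hws]; push_cast; ring
    rw [e1, e2]
    have p1 : 0 < 1 - s ^ 2 := by nlinarith
    have p2 : 1 - s ^ 4 = (1 - s ^ 2) * (1 + s ^ 2) := by ring
    simp only [mul_zero, sub_zero, one_pow, div_one, norm_mul, norm_div, norm_pow,
      Complex.norm_real, Complex.norm_ofNat]
    rw [Real.norm_of_nonneg p1.le, p2, Real.norm_of_nonneg (by positivity), ← hs]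
    have e3 : (1 - s ^ 2) / (1 - s ^ 2) ^ 2 * ((1 - s ^ 2) * (1 + s ^ 2) * ‖deriv F p‖ / (2 * s))
        = (1 + s ^ 2) / (2 * s) * ‖deriv F p‖ := by
      field_simp
    rw [e3]
    have h5 : 1 < (1 + s ^ 2) / (2 * s) := by
      rw [lt_div_iff₀ (by positivity)]
      nlinarith [sq_pos_of_pos (sub_pos.2 hs1)]
    have h6 : 0 < ‖deriv F p‖ := norm_pos_iff.2 hF'
    nlinarith

lemma exists_conformal_to_disc {U : Set ℂ} (hU : IsOpen U) (hUs : IsSimplyConnected U)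
    (hb : Bornology.IsBounded U) {p : ℂ} (hp : p ∈ U) :
    ∃ F : ℂ → ℂ, DifferentiableOn ℂ F U ∧ Set.InjOn F U ∧ F '' U = ball 0 1 ∧ F p = 0 ∧
      deriv F p ≠ 0 := by
  let Good : (ℂ → ℂ) → Prop := fun f ↦
    DifferentiableOn ℂ f U ∧ Set.InjOn f U ∧ Set.MapsTo f U (ball 0 1) ∧ f p = 0
  let S : Set ℝ := {x | ∃ f, Good f ∧ ‖deriv f p‖ = x}
  obtain ⟨r, hr, hrU⟩ := Metric.isOpen_iff.1 hU p hp
  have hSb : BddAbove S := by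
    refine ⟨1 / r, ?_⟩
    rintro _ ⟨f, hf, rfl⟩
    refine Complex.norm_deriv_le_div_of_mapsTo_ball (hf.1.mono hrU) (fun z hz ↦ ?_) hr
    rw [hf.2.2.2]
    exact Metric.ball_subset_closedBall (hf.2.2.1 (hrU hz))
  obtain ⟨R, hR, hRU⟩ : ∃ R : ℝ, 0 < R ∧ U ⊆ ball p R := by
    obtain ⟨R, hR⟩ := hb.subset_ball p
    refine ⟨max R 1, by positivity, hR.trans (Metric.ball_subset_ball (le_max_left _ _))⟩
  have hRS : 1 / R ∈ S := by
    refine ⟨fun z ↦ (z - p) / R, ⟨by fun_prop, fun z _ z' _ h ↦ ?_, fun z hz ↦ ?_, by simp⟩, ?_⟩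
    · have hRc : (R : ℂ) ≠ 0 := by exact_mod_cast hR.ne'
      simpa [div_left_inj' hRc] using h
    · have := hRU hz
      rw [mem_ball_iff_norm] at this
      rw [mem_ball_zero_iff, norm_div, Complex.norm_real, Real.norm_of_nonneg hR.le,
        div_lt_one hR]
      exact this
    · have : HasDerivAt (fun z : ℂ ↦ (z - p) / R) (1 / R) p :=
        ((hasDerivAt_id p).sub_const p).div_const _
      rw [this.deriv]
      simp [abs_of_pos hR]
  obtain ⟨u, -, hu, huS⟩ := exists_seq_tendsto_sSup ⟨_, hRS⟩ hSb
  choose f hf hfu using huS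
  obtain ⟨F, hF⟩ := exists_tendstoLocallyUniformlyOn hU f (fun n ↦ (hf n).1) (fun n ↦ (hf n).2.2.1)
  have hdF : DifferentiableOn ℂ F U := hF.differentiableOn (.of_forall fun n ↦ (hf n).1) hU
  have hderiv : ‖deriv F p‖ = sSup S := by
    have h1 := ((hF.deriv (.of_forall fun n ↦ (hf n).1) hU).tendsto_at hp).norm
    refine tendsto_nhds_unique h1 ?_
    refine (hu.mono_left Nat.hyperfilter_le_atTop).congr fun n ↦ ?_
    rw [← hfu n]; rfl
  have hpos : 0 < sSup S := lt_of_lt_of_le (by positivity) (le_csSup hSb hRS)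
  have hF' : deriv F p ≠ 0 := norm_pos_iff.1 (hderiv ▸ hpos)
  have hFi : Set.InjOn F U := injOn_of_tendstoLocallyUniformlyOn hU
    hUs.isPathConnected.isConnected.isPreconnected
    (fun n ↦ (hf n).1) (fun n ↦ (hf n).2.1) hF hp hF'
  have hFp : F p = 0 := by
    refine tendsto_nhds_unique (hF.tendsto_at hp) ?_
    simp only [(hf _).2.2.2]
    exact tendsto_const_nhds
  have hcl : ∀ z ∈ U, ‖F z‖ ≤ 1 := fun z hz ↦
    le_of_tendsto (hF.tendsto_at hz).norm
      (.of_forall fun n ↦ (mem_ball_zero_iff.1 ((hf n).2.2.1 hz)).le)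
  have hopen : IsOpen (F '' U) := by
    rcases (hdF.analyticOnNhd hU).is_constant_or_isOpen
      hUs.isPathConnected.isConnected.isPreconnected with ⟨w, hw⟩ | h
    · exfalso
      apply hF'
      have : F =ᶠ[𝓝 p] fun _ ↦ w := by
        filter_upwards [hU.mem_nhds hp] with z hz using hw z hz
      rw [this.deriv_eq, deriv_const]
    · exact h U subset_rfl hU
  have hFm : Set.MapsTo F U (ball 0 1) := by
    have h1 : F '' U ⊆ interior (closedBall 0 1) := interior_maximal (by
      rintro _ ⟨z, hz, rfl⟩
      exact mem_closedBall_zero_iff.2 (hcl z hz)) hopen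
    rw [interior_closedBall _ one_ne_zero] at h1
    exact fun z hz ↦ h1 ⟨z, hz, rfl⟩
  refine ⟨F, hdF, hFi, Set.Subset.antisymm hFm.image_subset fun w hw ↦ ?_, hFp, hF'⟩
  by_contra hwF
  obtain ⟨k, k1, k2, k3, k4, k5⟩ :=
    exists_deriv_lt_of_notMem_image hU hUs hdF hFi hFm hp hFp hF' hw hwF
  have := le_csSup hSb ⟨k, ⟨k1, k2, k3, k4⟩, rfl⟩
  linarith

/-- The inverse of the Riemann map. -/
lemma exists_conformal_of_disc {U : Set ℂ} (hU : IsOpen U) (hUs : IsSimplyConnected U)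
    (hb : Bornology.IsBounded U) :
    ∃ φ : OpenPartialHomeomorph ℂ ℂ, φ.source = ball 0 1 ∧ φ.target = U ∧
      DifferentiableOn ℂ φ (ball 0 1) ∧ deriv φ 0 ≠ 0 := by
  obtain ⟨p, hp⟩ := hUs.nonempty
  obtain ⟨F, hd, hi, hF, hFp, hF'⟩ := exists_conformal_to_disc hU hUs hb hp
  have hUc := hUs.isPathConnected.isConnected.isPreconnected
  have han := hd.analyticOnNhd hU
  set φ := Function.invFunOn F U with hφ
  have hmaps : ∀ w ∈ ball (0 : ℂ) 1, φ w ∈ U ∧ F (φ w) = w := by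
    intro w hw
    rw [← hF] at hw
    exact ⟨Function.invFunOn_mem hw, Function.invFunOn_eq hw⟩
  have hleft : ∀ z ∈ U, φ (F z) = z := fun z hz ↦ hi.leftInvOn_invFunOn hz
  have hFm : ∀ z ∈ U, F z ∈ ball (0 : ℂ) 1 := fun z hz ↦ hF ▸ ⟨z, hz, rfl⟩
  have hop : ∀ s ⊆ U, IsOpen s → IsOpen (F '' s) := by
    rcases han.is_constant_or_isOpen hUc with ⟨w, hw⟩ | h
    · exfalso
      apply hF'
      have : F =ᶠ[𝓝 p] fun _ ↦ w := by
        filter_upwards [hU.mem_nhds hp] with z hz using hw z hz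
      rw [this.deriv_eq, deriv_const]
    · exact h
  have hcont : ContinuousOn φ (ball 0 1) := by
    refine (continuousOn_open_iff Metric.isOpen_ball).2 fun t ht ↦ ?_
    have : ball (0 : ℂ) 1 ∩ φ ⁻¹' t = F '' (U ∩ t) := by
      ext w
      constructor
      · rintro ⟨hw, hwt⟩
        exact ⟨φ w, ⟨(hmaps w hw).1, hwt⟩, (hmaps w hw).2⟩
      · rintro ⟨z, ⟨hz, hzt⟩, rfl⟩
        exact ⟨hFm z hz, by rw [Set.mem_preimage, hleft z hz]; exact hzt⟩
    rw [this]
    exact hop _ Set.inter_subset_left (hU.inter ht)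
  have hcat : ∀ w ∈ ball (0 : ℂ) 1, ContinuousAt φ w := fun w hw ↦
    hcont.continuousAt (Metric.isOpen_ball.mem_nhds hw)
  have hgood : ∀ w ∈ ball (0 : ℂ) 1, deriv F (φ w) ≠ 0 → DifferentiableAt ℂ φ w := by
    intro w hw h
    refine (HasDerivAt.of_local_left_inverse (hcat w hw)
      (hd.differentiableAt (hU.mem_nhds (hmaps w hw).1)).hasDerivAt h ?_).differentiableAt
    filter_upwards [Metric.isOpen_ball.mem_nhds hw] with y hy using (hmaps y hy).2
  have hdφ : DifferentiableOn ℂ φ (ball 0 1) := by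
    intro w hw
    have hev : ∀ᶠ z in 𝓝[≠] (φ w), deriv F z ≠ 0 := by
      by_contra hcon
      exact hF' ((han.deriv).eqOn_zero_of_preconnected_of_frequently_eq_zero hUc
        (hmaps w hw).1 hcon hp)
    have hN : ball (0 : ℂ) 1 ∩ φ ⁻¹' {z | z ≠ φ w → deriv F z ≠ 0} ∈ 𝓝 w :=
      Filter.inter_mem (Metric.isOpen_ball.mem_nhds hw)
        (hcat w hw (eventually_nhdsWithin_iff.1 hev))
    refine (((Complex.differentiableOn_compl_singleton_and_continuousAt_iff hN).1
      ⟨fun y hy ↦ ?_, hcat w hw⟩).differentiableAt hN).differentiableWithinAt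
    refine (hgood y hy.1.1 (hy.1.2 fun h ↦ hy.2 ?_)).differentiableWithinAt
    rw [Set.mem_singleton_iff, ← (hmaps y hy.1.1).2, h, (hmaps w hw).2]
  have h0 : (0 : ℂ) ∈ ball (0 : ℂ) 1 := by simp
  let e : OpenPartialHomeomorph ℂ ℂ :=
    { toFun := φ
      invFun := F
      source := ball 0 1
      target := U
      map_source' := fun w hw ↦ (hmaps w hw).1
      map_target' := hFm
      left_inv' := fun w hw ↦ (hmaps w hw).2
      right_inv' := hleft
      open_source := Metric.isOpen_ball
      open_target := hU
      continuousOn_toFun := hcont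
      continuousOn_invFun := hd.continuousOn }
  refine ⟨e, rfl, rfl, hdφ, ?_⟩
  change deriv φ 0 ≠ 0
  have hφ0 : φ 0 = p := by rw [← hFp, hleft p hp]
  have h1 := (HasDerivAt.of_local_left_inverse (hcat 0 h0) (f' := deriv F p)
      (by rw [hφ0]; exact (hd.differentiableAt (hU.mem_nhds hp)).hasDerivAt) hF'
      (by filter_upwards [Metric.isOpen_ball.mem_nhds h0] with y hy using (hmaps y hy).2))
  rw [h1.deriv]
  exact inv_ne_zero hF'

end SphereHomeo

namespace SphereHomeo
open OnePoint Filter Topology MeasureTheory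
open Metric (ball closedBall sphere)

lemma det_smul_one (a : ℂ) : (a • (1 : ℂ →L[ℝ] ℂ)).det = ‖a‖ ^ 2 := by
  have h : ((a • (1 : ℂ →L[ℝ] ℂ) : ℂ →L[ℝ] ℂ) : ℂ →ₗ[ℝ] ℂ) = Algebra.lmul ℝ ℂ a := by
    ext
    simp
  rw [ContinuousLinearMap.det, h, ← Complex.normSq_eq_norm_sq, ← Algebra.norm_complex_apply,
    Algebra.norm_apply]

lemma lintegral_deriv_sq_eq_volume_image {s : Set ℂ} (hs : IsOpen s) {φ : ℂ → ℂ}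
    (hd : DifferentiableOn ℂ φ s) (hi : Set.InjOn φ s) :
    ∫⁻ z in s, ENNReal.ofReal (‖deriv φ z‖ ^ 2) = volume (φ '' s) := by
  rw [← lintegral_abs_det_fderiv_eq_addHaar_image volume hs.measurableSet
    (f' := fun z ↦ deriv φ z • (1 : ℂ →L[ℝ] ℂ)) (fun z hz ↦
      (hd.differentiableAt (hs.mem_nhds hz)).hasDerivAt.complexToReal_fderiv.hasFDerivWithinAt) hi]
  simp only [det_smul_one, abs_pow, abs_norm]

/-- Polar coordinates. -/
noncomputable def polar (r θ : ℝ) : ℂ := r * (Real.cos θ + Real.sin θ * Complex.I)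

lemma polar_eq_exp (r θ : ℝ) : polar r θ = r * Complex.exp (θ * Complex.I) := by
  rw [polar, Complex.exp_mul_I]; push_cast; rfl

lemma norm_polar {r : ℝ} (hr : 0 ≤ r) (θ : ℝ) : ‖polar r θ‖ = r := by
  rw [polar_eq_exp, norm_mul, Complex.norm_exp_ofReal_mul_I, Complex.norm_real,
    Real.norm_of_nonneg hr, mul_one]

lemma polar_re (r θ : ℝ) : (polar r θ).re = r * Real.cos θ := by
  rw [polar]
  simp [-Complex.ofReal_cos, -Complex.ofReal_sin]

lemma mem_ball_one_one_iff {z : ℂ} : z ∈ ball (1 : ℂ) 1 ↔ ‖z‖ ^ 2 < 2 * z.re := by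
  rw [mem_ball_iff_norm, ← pow_lt_one_iff_of_nonneg (norm_nonneg (z - 1)) two_ne_zero,
    ← Complex.normSq_eq_norm_sq, ← Complex.normSq_eq_norm_sq]
  simp only [Complex.normSq_apply, Complex.sub_re, Complex.sub_im, Complex.one_re, Complex.one_im]
  constructor <;> intro h <;> nlinarith

lemma polar_mem_ball_iff {r θ : ℝ} (hr : 0 < r) :
    polar r θ ∈ ball (1 : ℂ) 1 ↔ r / 2 < Real.cos θ := by
  rw [mem_ball_one_one_iff, norm_polar hr.le, polar_re]
  constructor <;> intro h <;> nlinarith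

lemma lintegral_polar (f : ℂ → ENNReal) (hf : Measurable f) :
    ∫⁻ z, f z = ∫⁻ r in Set.Ioi (0 : ℝ), ENNReal.ofReal r *
      ∫⁻ θ in Set.Ioo (-Real.pi) Real.pi, f (polar r θ) := by
  have hm : Measurable fun p : ℝ × ℝ ↦ f (polar p.1 p.2) := by
    refine hf.comp (Continuous.measurable ?_)
    unfold polar
    fun_prop
  rw [← Complex.lintegral_comp_polarCoord_symm]
  have hs : ∀ p : ℝ × ℝ, ENNReal.ofReal p.1 • f (Complex.polarCoord.symm p) =
      ENNReal.ofReal p.1 * f (polar p.1 p.2) := fun p ↦ by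
    rw [Complex.polarCoord_symm_apply, smul_eq_mul, polar]
  simp only [hs]
  have : polarCoord.target = Set.Ioi (0 : ℝ) ×ˢ Set.Ioo (-Real.pi) Real.pi := rfl
  rw [this, Measure.volume_eq_prod, ← Measure.prod_restrict, lintegral_prod]
  · refine lintegral_congr fun r ↦ ?_
    exact lintegral_const_mul (ENNReal.ofReal r) (hm.of_uncurry_left (f := fun r θ ↦ f (polar r θ)))
  · exact ((measurable_fst.ennreal_ofReal).mul hm).aemeasurable

lemma exists_small_arc_integral {φ : ℂ → ℂ} (hd : DifferentiableOn ℂ φ (ball 1 1))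
    (hi : Set.InjOn φ (ball 1 1)) (hb : Bornology.IsBounded (φ '' ball 1 1))
    {δ c : ℝ} (hδ : 0 < δ) (hc : 0 < c) : ∃ r ∈ Set.Ioo 0 δ,
      ∫⁻ θ in Set.Ioo (-Real.pi) Real.pi, (ball (1 : ℂ) 1).indicator
        (fun z ↦ ENNReal.ofReal (‖deriv φ z‖ ^ 2)) (polar r θ) < ENNReal.ofReal (c / r ^ 2) := by
  by_contra! hcon
  set f : ℂ → ENNReal := (ball (1 : ℂ) 1).indicator
        (fun z ↦ ENNReal.ofReal (‖deriv φ z‖ ^ 2)) with hf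
  have hfm : Measurable f :=
    (((measurable_deriv φ).norm.pow_const 2).ennreal_ofReal).indicator measurableSet_ball
  have hfin : ∫⁻ z, f z < ⊤ := by
    rw [hf, lintegral_indicator measurableSet_ball,
      lintegral_deriv_sq_eq_volume_image Metric.isOpen_ball hd hi]
    exact hb.measure_lt_top
  rw [lintegral_polar f hfm] at hfin
  have hle : ∫⁻ r in Set.Ioo (0 : ℝ) δ, ENNReal.ofReal (c * r⁻¹) ≤
      ∫⁻ r in Set.Ioi (0 : ℝ), ENNReal.ofReal r *
        ∫⁻ θ in Set.Ioo (-Real.pi) Real.pi, f (polar r θ) := by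
    refine le_trans ?_ (lintegral_mono_set (s := Set.Ioo 0 δ) (t := Set.Ioi 0) fun r hr ↦ hr.1)
    refine setLIntegral_mono' measurableSet_Ioo fun r hr ↦ ?_
    calc ENNReal.ofReal (c * r⁻¹) = ENNReal.ofReal r * ENNReal.ofReal (c / r ^ 2) := by
          rw [← ENNReal.ofReal_mul hr.1.le]
          congr 1
          have := hr.1.ne'
          field_simp
      _ ≤ _ := by gcongr; exact hcon r hr
  have hintg : IntegrableOn (fun r : ℝ ↦ c * r⁻¹) (Set.Ioo 0 δ) := by
    refine ⟨by fun_prop, ?_⟩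
    rw [hasFiniteIntegral_iff_ofReal]
    · exact hle.trans_lt hfin
    · filter_upwards [ae_restrict_mem measurableSet_Ioo] with r hr
      exact mul_nonneg hc.le (inv_nonneg.2 hr.1.le)
  have h2 : IntervalIntegrable (fun r : ℝ ↦ r⁻¹) volume 0 δ := by
    rw [intervalIntegrable_iff_integrableOn_Ioo_of_le hδ.le]
    have := hintg.const_mul c⁻¹
    simpa [IntegrableOn, ← mul_assoc, inv_mul_cancel₀ hc.ne'] using this
  rw [intervalIntegrable_inv_iff] at h2
  simp [hδ.ne] at h2

/-- The length-area principle: there are arbitrarily small arcs around a boundary point whose images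
under a conformal map are short. -/
lemma exists_short_crosscut {φ : ℂ → ℂ} (hd : DifferentiableOn ℂ φ (ball 1 1))
    (hi : Set.InjOn φ (ball 1 1)) (hb : Bornology.IsBounded (φ '' ball 1 1))
    {δ ε : ℝ} (hδ : 0 < δ) (hε : 0 < ε) : ∃ r ∈ Set.Ioo 0 δ, ∀ z ∈ ball (1 : ℂ) 1,
      ∀ w ∈ ball (1 : ℂ) 1, ‖z‖ = r → ‖w‖ = r → ‖φ z - φ w‖ < ε := by
  have hπ := Real.pi_pos
  obtain ⟨r, hr, hA⟩ := exists_small_arc_integral hd hi hb hδ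
    (c := ε ^ 2 / Real.pi) (by positivity)
  refine ⟨r, hr, ?_⟩
  have hr0 := hr.1
  have harg : ∀ z : ℂ, ‖z‖ = r → polar r z.arg = z := by
    intro z hz
    rw [polar_eq_exp, ← hz, Complex.norm_mul_exp_arg_mul_I]
  have main : ∀ α β : ℝ, -Real.pi < α → β ≤ Real.pi → α ≤ β → polar r α ∈ ball (1 : ℂ) 1 →
      polar r β ∈ ball (1 : ℂ) 1 → ‖φ (polar r β) - φ (polar r α)‖ < ε := by
    intro α β hα hβ hαβ h1 h2
    rw [polar_mem_ball_iff hr0] at h1 h2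
    have hmem : ∀ θ ∈ Set.Icc α β, polar r θ ∈ ball (1 : ℂ) 1 := by
      intro θ hθ
      rw [polar_mem_ball_iff hr0]
      rcases le_total 0 θ with h0 | h0
      · exact h2.trans_le (Real.cos_le_cos_of_nonneg_of_le_pi h0 hβ hθ.2)
      · rw [← Real.cos_neg] at h1 ⊢
        exact h1.trans_le (Real.cos_le_cos_of_nonneg_of_le_pi (by linarith)
          (by linarith) (by linarith [hθ.1]))
    have hpd : ∀ θ : ℝ, HasDerivAt (fun θ : ℝ ↦ polar r θ) (polar r θ * Complex.I) θ := by
      intro θ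
      simp only [polar_eq_exp]
      have := ((((hasDerivAt_id θ).ofReal_comp).mul_const Complex.I).cexp).const_mul (r : ℂ)
      refine this.congr_deriv ?_
      simp [mul_assoc]
    have hder : ∀ θ ∈ Set.uIcc α β, HasDerivAt (fun θ : ℝ ↦ φ (polar r θ))
        (deriv φ (polar r θ) * (polar r θ * Complex.I)) θ := by
      intro θ hθ
      rw [Set.uIcc_of_le hαβ] at hθ
      exact HasDerivAt.comp θ (hd.differentiableAt
        (Metric.isOpen_ball.mem_nhds (hmem θ hθ))).hasDerivAt (hpd θ)
    have hpc : Continuous fun θ : ℝ ↦ polar r θ := by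
      unfold polar
      fun_prop
    have hcd : ContinuousOn (fun θ : ℝ ↦ deriv φ (polar r θ)) (Set.uIcc α β) := by
      rw [Set.uIcc_of_le hαβ]
      exact ((hd.deriv Metric.isOpen_ball).continuousOn).comp hpc.continuousOn hmem
    have hintg : IntervalIntegrable (fun θ ↦ deriv φ (polar r θ) * (polar r θ * Complex.I))
        volume α β :=
      (hcd.mul (by fun_prop)).intervalIntegrable
    rw [← intervalIntegral.integral_eq_sub_of_hasDerivAt hder hintg]
    refine (intervalIntegral.norm_integral_le_integral_norm hαβ).trans_lt ?_
    set s := Real.pi / ε with hs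
    have hs0 : 0 < s := by positivity
    have hsqi : IntervalIntegrable (fun θ ↦ ‖deriv φ (polar r θ)‖ ^ 2) volume α β :=
      (hcd.norm.pow 2).intervalIntegrable
    have hle : ∫ θ in α..β, ‖deriv φ (polar r θ) * (polar r θ * Complex.I)‖ ≤
        ∫ θ in α..β, (s / 2 * r ^ 2 * ‖deriv φ (polar r θ)‖ ^ 2 + 1 / (2 * s)) := by
      refine intervalIntegral.integral_mono_on hαβ hintg.norm
        ((hsqi.const_mul _).add intervalIntegrable_const) fun θ hθ ↦ ?_
      rw [norm_mul, norm_mul, Complex.norm_I, norm_polar hr0.le, mul_one]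
      set x := ‖deriv φ (polar r θ)‖
      have e1 : s / 2 * r ^ 2 * x ^ 2 + 1 / (2 * s) - x * r = (s * (x * r) - 1) ^ 2 / (2 * s) := by
        field_simp
        ring
      have e2 : 0 ≤ (s * (x * r) - 1) ^ 2 / (2 * s) := by positivity
      linarith
    refine hle.trans_lt ?_
    rw [intervalIntegral.integral_add (hsqi.const_mul _) intervalIntegrable_const,
      intervalIntegral.integral_const_mul, intervalIntegral.integral_const, smul_eq_mul]
    have hI : ∫ θ in α..β, ‖deriv φ (polar r θ)‖ ^ 2 < ε ^ 2 / Real.pi / r ^ 2 := by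
      rw [intervalIntegral.integral_of_le hαβ]
      rw [← ENNReal.ofReal_lt_ofReal_iff (by positivity)]
      rw [ofReal_integral_eq_lintegral_ofReal
        ((intervalIntegrable_iff_integrableOn_Ioc_of_le hαβ).1 hsqi)
        (.of_forall fun θ ↦ by positivity)]
      refine lt_of_le_of_lt ?_ hA
      rw [restrict_Ioo_eq_restrict_Ioc]
      refine le_trans ?_ (lintegral_mono_set (Set.Ioc_subset_Ioc hα.le hβ))
      refine setLIntegral_mono' measurableSet_Ioc fun θ hθ ↦ ?_
      rw [Set.indicator_of_mem (hmem θ (Set.Ioc_subset_Icc_self hθ))]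
    have hαβ' : β - α < Real.pi := by
      have a1 : 0 < Real.cos α := by linarith
      have a2 : 0 < Real.cos β := by linarith
      have b1 : -(Real.pi / 2) < α := by
        by_contra! h
        have := Real.cos_nonpos_of_pi_div_two_le_of_le (x := -α) (by linarith) (by linarith)
        rw [Real.cos_neg] at this
        linarith
      have b2 : β < Real.pi / 2 := by
        by_contra! h
        have := Real.cos_nonpos_of_pi_div_two_le_of_le (x := β) (by linarith) (by linarith)
        linarith
      linarith
    have f1 : s / 2 * r ^ 2 * (∫ θ in α..β, ‖deriv φ (polar r θ)‖ ^ 2) < ε / 2 := by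
      calc _ < s / 2 * r ^ 2 * (ε ^ 2 / Real.pi / r ^ 2) := by gcongr
        _ = ε / 2 := by rw [hs]; field_simp
    have f2 : (β - α) * (1 / (2 * s)) < ε / 2 := by
      calc _ < Real.pi * (1 / (2 * s)) := by gcongr
        _ = ε / 2 := by rw [hs]; field_simp
    linarith
  intro z hz w hw hzr hwr
  rw [← harg z hzr] at hz ⊢
  rw [← harg w hwr] at hw ⊢
  rcases le_total z.arg w.arg with h | h
  · rw [norm_sub_rev]
    exact main _ _ (Complex.neg_pi_lt_arg z) (Complex.arg_le_pi w) h hz hw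
  · exact main _ _ (Complex.neg_pi_lt_arg w) (Complex.arg_le_pi z) h hw hz

end SphereHomeo

namespace SphereHomeo
open OnePoint Filter Topology
open Metric (ball closedBall sphere)
open scoped ComplexConjugate

lemma exists_short_crosscut_at {φ : ℂ → ℂ} (hd : DifferentiableOn ℂ φ (ball 0 1))
    (hi : Set.InjOn φ (ball 0 1)) (hb : Bornology.IsBounded (φ '' ball 0 1))
    {ζ : ℂ} (hζ : ‖ζ‖ = 1) {δ ε : ℝ} (hδ : 0 < δ) (hε : 0 < ε) : ∃ r ∈ Set.Ioo 0 δ,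
      ∀ z ∈ ball (0 : ℂ) 1, ∀ w ∈ ball (0 : ℂ) 1, ‖z - ζ‖ = r → ‖w - ζ‖ = r →
        ‖φ z - φ w‖ < ε := by
  have hζ0 : ζ ≠ 0 := by rintro rfl; simp at hζ
  have hm : Set.MapsTo (fun w ↦ ζ * (1 - w)) (ball (1 : ℂ) 1) (ball 0 1) := by
    intro w hw
    rw [mem_ball_iff_norm'] at hw
    rw [mem_ball_zero_iff, norm_mul, hζ, one_mul]
    exact hw
  obtain ⟨r, hr, H⟩ := exists_short_crosscut (φ := fun w ↦ φ (ζ * (1 - w)))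
    (hd.comp (by fun_prop) hm)
    (fun w hw w' hw' h ↦ by
      have := hi (hm hw) (hm hw') h
      simpa [hζ0] using this)
    (hb.subset (by
      rintro _ ⟨w, hw, rfl⟩
      exact ⟨_, hm hw, rfl⟩)) hδ hε
  have hinv : ∀ z : ℂ, ζ * (1 - (1 - ζ⁻¹ * z)) = z := fun z ↦ by field_simp; ring
  have hn : ∀ z : ℂ, ‖1 - ζ⁻¹ * z‖ = ‖z - ζ‖ := fun z ↦ by
    have : 1 - ζ⁻¹ * z = ζ⁻¹ * (ζ - z) := by field_simp
    rw [this, norm_mul, norm_inv, hζ, inv_one, one_mul, norm_sub_rev]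
  have hB : ∀ z ∈ ball (0 : ℂ) 1, 1 - ζ⁻¹ * z ∈ ball (1 : ℂ) 1 := fun z hz ↦ by
    rw [mem_ball_zero_iff] at hz
    rw [mem_ball_iff_norm]
    simpa [hζ] using hz
  refine ⟨r, hr, fun z hz w hw h1 h2 ↦ ?_⟩
  have := H _ (hB z hz) _ (hB w hw) ((hn z).trans h1) ((hn w).trans h2)
  simpa only [hinv] using this

/-- A cap of the unit disc has small diameter. -/
lemma norm_sub_sq_le_of_cap {e v : ℂ} (he : ‖e‖ = 1) (hv : ‖v‖ ≤ 1) {t : ℝ}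
    (h : 1 - t ≤ (v * conj e).re) : ‖v - e‖ ^ 2 ≤ 2 * t := by
  have h1 : ‖v - e‖ ^ 2 = ‖v‖ ^ 2 - 2 * (v * conj e).re + ‖e‖ ^ 2 := by
    simp only [← Complex.normSq_eq_norm_sq, Complex.normSq_apply, Complex.sub_re, Complex.sub_im,
      Complex.mul_re, Complex.conj_re, Complex.conj_im]
    ring
  rw [h1, he]
  nlinarith [norm_nonneg v]

variable {u : OpenPartialHomeomorph ℂ ℂ}

lemma exists_norm_lt_of_norm_le (hs : u.source = ball 0 1) (ht : u.target = ball 0 1)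
    {ρ : ℝ} (hρ : ρ < 1) : ∃ σ < 1, ∀ z ∈ ball (0 : ℂ) 1, ‖u z‖ ≤ ρ → ‖z‖ ≤ σ := by
  have hK : IsCompact (u.symm '' closedBall 0 ρ) :=
    (isCompact_closedBall 0 ρ).image_of_continuousOn (u.continuousOn_symm.mono (by
      rw [ht]; exact Metric.closedBall_subset_ball hρ))
  rcases (closedBall (0 : ℂ) ρ).eq_empty_or_nonempty with h0 | hne
  · refine ⟨0, one_pos, fun z hz h ↦ ?_⟩
    have : u z ∈ closedBall (0 : ℂ) ρ := mem_closedBall_zero_iff.2 h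
    simp [h0] at this
  · obtain ⟨z0, ⟨v, hv, rfl⟩, hmax⟩ := hK.exists_isMaxOn (hne.image _) continuous_norm.continuousOn
    refine ⟨‖u.symm v‖, ?_, fun z hz h ↦ ?_⟩
    · have := u.map_target (x := v) (by rw [ht]; exact Metric.closedBall_subset_ball hρ hv)
      rw [hs, mem_ball_zero_iff] at this
      exact this
    · exact hmax ⟨u z, mem_closedBall_zero_iff.2 h, u.left_inv (by rw [hs]; exact hz)⟩

/-- The boundary Cauchy criterion. -/
lemma exists_cauchy_of_crosscut (hs : u.source = ball 0 1) (ht : u.target = ball 0 1)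
    {ζ : ℂ} (hζ : ‖ζ‖ = 1)
    (hc : ∀ δ > 0, ∀ ε > 0, ∃ r ∈ Set.Ioo (0 : ℝ) δ, ∀ z ∈ ball (0 : ℂ) 1, ∀ w ∈ ball (0 : ℂ) 1,
      ‖z - ζ‖ = r → ‖w - ζ‖ = r → ‖u z - u w‖ < ε) {ε : ℝ} (hε : 0 < ε) :
    ∃ r > 0, ∀ z ∈ ball (0 : ℂ) 1, ∀ w ∈ ball (0 : ℂ) 1, ‖z - ζ‖ < r → ‖w - ζ‖ < r →
      ‖u z - u w‖ < ε := by
  have hum : ∀ z ∈ ball (0 : ℂ) 1, ‖u z‖ < 1 := fun z hz ↦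
    mem_ball_zero_iff.1 (ht ▸ u.map_source (hs.symm ▸ hz))
  obtain ⟨t, ht0, ht1, ht2⟩ : ∃ t > 0, t < 1 / 10 ∧ 24 * t < ε ^ 2 :=
    ⟨min (1 / 20) (ε ^ 2 / 48), by positivity, (min_le_left _ _).trans_lt (by norm_num), by
      have := min_le_right (1 / 20 : ℝ) (ε ^ 2 / 48)
      have : 0 < ε ^ 2 := by positivity
      linarith⟩
  obtain ⟨σ, hσ1, hσ⟩ := exists_norm_lt_of_norm_le hs ht (ρ := 1 - t) (by linarith)
  obtain ⟨r, ⟨hr0, hrδ⟩, hr⟩ := hc (min (1 - σ) 1) (lt_min (by linarith) one_pos) t ht0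
  have hr1 : r < 1 := hrδ.trans_le (min_le_right _ _)
  have hrσ : r < 1 - σ := hrδ.trans_le (min_le_left _ _)
  have hnear : ∀ z ∈ ball (0 : ℂ) 1, ‖z - ζ‖ ≤ r → 1 - t < ‖u z‖ := by
    intro z hz hzr
    by_contra! h
    have h1 := hσ z hz h
    have h2 := norm_sub_norm_le ζ z
    rw [norm_sub_rev, hζ] at h2
    linarith
  set z0 := ζ * (1 - r) with hz0
  have hz0n : ‖z0‖ = 1 - r := by
    have : (1 - r : ℂ) = ((1 - r : ℝ) : ℂ) := by push_cast; rfl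
    rw [hz0, norm_mul, hζ, one_mul, this, Complex.norm_real, Real.norm_of_nonneg (by linarith)]
  have hz0b : z0 ∈ ball (0 : ℂ) 1 := by rw [mem_ball_zero_iff, hz0n]; linarith
  have hz0r : ‖z0 - ζ‖ = r := by
    have : z0 - ζ = -(ζ * r) := by rw [hz0]; ring
    rw [this, norm_neg, norm_mul, hζ, one_mul, Complex.norm_real, Real.norm_of_nonneg hr0.le]
  set c := u z0 with hcdef
  have hcn : 1 - t < ‖c‖ := hnear z0 hz0b hz0r.le
  have hcp : 0 < ‖c‖ := by linarith
  set e : ℂ := c / ‖c‖ with he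
  have hen : ‖e‖ = 1 := by
    rw [he, norm_div, Complex.norm_real, norm_norm, div_self hcp.ne']
  have hce : (c * conj e).re = ‖c‖ := by
    rw [he, map_div₀, Complex.conj_ofReal, mul_div_assoc', Complex.mul_conj,
      Complex.normSq_eq_norm_sq, ← Complex.ofReal_div, Complex.ofReal_re]
    field_simp
  have harc : ∀ z ∈ ball (0 : ℂ) 1, ‖z - ζ‖ = r → 1 - 3 * t < (u z * conj e).re := by
    intro z hz hzr
    have h1 := hr z hz z0 hz0b hzr hz0r
    have h2 : -‖(u z - c) * conj e‖ ≤ ((u z - c) * conj e).re :=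
      neg_le_of_abs_le (Complex.abs_re_le_norm _)
    rw [norm_mul, Complex.norm_conj, hen, mul_one, sub_mul, Complex.sub_re, hce] at h2
    linarith
  have hcap : ∀ z ∈ ball (0 : ℂ) 1, ‖z - ζ‖ < r → 1 - 3 * t < (u z * conj e).re := by
    intro z hz hzr
    by_contra! hcon
    set L : Set ℂ := ball 0 1 ∩ {v | (v * conj e).re ≤ 1 - 3 * t} with hL
    have hLc : Convex ℝ L := by
      refine (convex_ball _ _).inter (convex_halfSpace_le ⟨fun x y ↦ ?_, fun a x ↦ ?_⟩ _)
      · rw [add_mul, Complex.add_re]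
      · rw [smul_mul_assoc, Complex.smul_re]
    have hLt : L ⊆ u.target := by rw [ht]; exact Set.inter_subset_left
    have hconn : IsPreconnected (u.symm '' L) :=
      hLc.isPreconnected.image _ (u.continuousOn_symm.mono hLt)
    have h0L : (0 : ℂ) ∈ L := ⟨by simp, by simp; linarith⟩
    have m1 : z ∈ u.symm '' L := ⟨u z, ⟨mem_ball_zero_iff.2 (hum z hz), hcon⟩,
      u.left_inv (hs.symm ▸ hz)⟩
    have m2 : u.symm 0 ∈ u.symm '' L := ⟨0, h0L, rfl⟩
    have hsub : ∀ y ∈ u.symm '' L, y ∈ ball (0 : ℂ) 1 ∧ (u y * conj e).re ≤ 1 - 3 * t := by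
      rintro _ ⟨v, hv, rfl⟩
      refine ⟨hs ▸ u.map_target (hLt hv), ?_⟩
      rw [u.right_inv (hLt hv)]
      exact hv.2
    have hfar : r < ‖u.symm 0 - ζ‖ := by
      by_contra! h
      have := hnear _ (hsub _ m2).1 h
      rw [u.right_inv (hLt h0L), norm_zero] at this
      linarith
    obtain ⟨y, hy, hyr⟩ := hconn.intermediate_value m1 m2
      (f := fun y ↦ ‖y - ζ‖) (by fun_prop) ⟨hzr.le, hfar.le⟩
    have := harc y (hsub y hy).1 hyr
    linarith [(hsub y hy).2]
  refine ⟨r, hr0, fun z hz w hw hzr hwr ↦ ?_⟩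
  have d : ∀ z ∈ ball (0 : ℂ) 1, ‖z - ζ‖ < r → ‖u z - e‖ < ε / 2 := by
    intro z hz hzr
    have := norm_sub_sq_le_of_cap hen (hum z hz).le (hcap z hz hzr).le
    rw [← sq_lt_sq₀ (norm_nonneg _) (by positivity)]
    linarith
  have h1 := d z hz hzr
  have h2 := d w hw hwr
  rw [norm_sub_rev] at h2
  have h3 := norm_sub_le_norm_sub_add_norm_sub (u z) e (u w)
  linarith

end SphereHomeo

namespace SphereHomeo
open OnePoint Filter Topology
open Metric (ball closedBall sphere)
open scoped ComplexConjugate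

/-- A bounded holomorphic function which is constant on a boundary arc is constant. -/
lemma eq_of_eqOn_arc {f : ℂ → ℂ} (hf : DiffContOnCl ℂ f (ball 0 1)) {ζ c : ℂ} (hζ : ‖ζ‖ = 1)
    {α β : ℝ} (hαβ : α < β)
    (h : ∀ θ ∈ Set.Ioo α β, f (ζ * Complex.exp (θ * Complex.I)) = c) : f 0 = c := by
  have hπ := Real.pi_pos
  have hζ0 : ζ ≠ 0 := by rintro rfl; simp at hζ
  obtain ⟨n, hn⟩ := exists_nat_gt (2 * Real.pi / (β - α))
  have hn0 : 0 < (n : ℝ) := lt_of_le_of_lt (div_nonneg (by positivity) (by linarith)) hn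
  set κ : ℝ := 2 * Real.pi / n with hκ
  have hκ0 : 0 < κ := by positivity
  have hκ1 : κ < β - α := by
    rw [div_lt_iff₀ (by linarith)] at hn
    rw [hκ, div_lt_iff₀ hn0]
    linarith
  have hrot : ∀ k : ℕ, Set.MapsTo (fun z : ℂ ↦ Complex.exp ((κ * k : ℝ) * Complex.I) * z)
      (ball 0 1) (ball 0 1) := fun k z hz ↦ by
    rw [mem_ball_zero_iff] at hz ⊢
    rwa [norm_mul, Complex.norm_exp_ofReal_mul_I, one_mul]
  have hF : DiffContOnCl ℂ (fun z ↦ ∏ k ∈ Finset.range n,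
      (f (Complex.exp ((κ * k : ℝ) * Complex.I) * z) - c)) (ball 0 1) := by
    have h1 : ∀ k : ℕ, DiffContOnCl ℂ
        (fun z ↦ f (Complex.exp ((κ * k : ℝ) * Complex.I) * z) - c) (ball 0 1) := fun k ↦
      (hf.comp (Differentiable.diffContOnCl (by fun_prop)) (hrot k)).sub_const c
    constructor
    · exact DifferentiableOn.fun_finsetProd fun k _ ↦ (h1 k).1
    · exact continuousOn_finsetProd _ fun k _ ↦ (h1 k).2
  have h0 := Complex.norm_le_of_forall_mem_frontier_norm_le Metric.isBounded_ball hF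
    (C := 0) (fun z hz ↦ ?_) (subset_closure (Metric.mem_ball_self one_pos))
  · simp only [mul_zero, Finset.prod_const, Finset.card_range] at h0
    exact sub_eq_zero.1 (eq_zero_of_pow_eq_zero (norm_le_zero_iff.1 h0))
  · rw [frontier_ball _ one_ne_zero, mem_sphere_zero_iff_norm] at hz
    refine le_of_eq (norm_eq_zero.2 ?_)
    set θ := (ζ⁻¹ * z).arg with hθ
    have hzθ : ζ * Complex.exp (θ * Complex.I) = z := by
      have := Complex.norm_mul_exp_arg_mul_I (ζ⁻¹ * z)
      rw [norm_mul, norm_inv, hζ, hz, inv_one, one_mul, Complex.ofReal_one, one_mul] at this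
      rw [hθ, this, mul_inv_cancel_left₀ hζ0]
    set K : ℤ := ⌊(α - θ) / κ⌋ + 1 with hK
    have hK1 : α < θ + κ * K := by
      have := Int.lt_floor_add_one ((α - θ) / κ)
      rw [div_lt_iff₀ hκ0] at this
      rw [hK]
      push_cast
      linarith
    have hK2 : θ + κ * K < β := by
      have := Int.floor_le ((α - θ) / κ)
      rw [le_div_iff₀ hκ0] at this
      rw [hK]
      push_cast
      linarith
    have hnZ : (0 : ℤ) < n := by exact_mod_cast hn0
    have hk0 := Int.emod_nonneg K hnZ.ne'
    have hk1 := Int.emod_lt_of_pos K hnZ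
    obtain ⟨k, hk⟩ := Int.eq_ofNat_of_zero_le hk0
    refine Finset.prod_eq_zero (i := k) (Finset.mem_range.2 (by omega)) ?_
    rw [sub_eq_zero, ← h _ ⟨hK1, hK2⟩]
    congr 1
    nth_rewrite 1 [← hzθ]
    rw [mul_left_comm, ← Complex.exp_add]
    congr 1
    rw [Complex.exp_eq_exp_iff_exists_int]
    refine ⟨-(K / n), ?_⟩
    have e1 : (K : ℂ) = (n : ℂ) * ((K / n : ℤ) : ℂ) + (k : ℂ) := by
      have := Int.mul_ediv_add_emod K n
      rw [hk] at this
      exact_mod_cast this.symm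
    have e2 : (κ : ℂ) * n = 2 * Real.pi := by
      rw [hκ]
      push_cast
      have : (n : ℂ) ≠ 0 := by exact_mod_cast hn0.ne'
      field_simp
    push_cast
    rw [e1]
    linear_combination (-((K / n : ℤ) : ℂ) * Complex.I) * e2

lemma cos_sub_lt_of_lt {α γ : ℝ} (h0 : 0 < α) (h1 : α < γ) (h2 : γ < 2 * Real.pi) :
    Real.cos ((α + γ) / 2) < Real.cos ((γ - α) / 2) := by
  rcases le_total ((α + γ) / 2) Real.pi with h | h
  · exact Real.cos_lt_cos_of_nonneg_of_le_pi (by linarith) h (by linarith)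
  · rw [← Real.cos_two_pi_sub]
    exact Real.cos_lt_cos_of_nonneg_of_le_pi (by linarith) (by linarith) (by linarith)

lemma cos_lt_cos_sub_of_mem {α β γ : ℝ} (h0 : α < β) (h1 : β < γ) (h2 : γ - α < 2 * Real.pi) :
    Real.cos ((γ - α) / 2) < Real.cos (β - (α + γ) / 2) := by
  rw [← Real.cos_abs (β - _)]
  refine Real.cos_lt_cos_of_nonneg_of_le_pi (abs_nonneg _) (by linarith) ?_
  rw [abs_lt]
  constructor <;> linarith

variable {u : OpenPartialHomeomorph ℂ ℂ}

/-- A continuous extension of a homeomorphism of the disc to the closed disc that is nonconstant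
on boundary arcs is injective on the circle. -/
lemma injOn_sphere_of_extension (hs : u.source = ball 0 1) (ht : u.target = ball 0 1)
    {g : ℂ → ℂ} (hg : ContinuousOn g (closedBall 0 1)) (hgu : Set.EqOn g u (ball 0 1))
    (hgs : ∀ z, ‖z‖ = 1 → ‖g z‖ = 1)
    (hna : ∀ ζ ω : ℂ, ‖ζ‖ = 1 → ‖ω‖ = 1 → ∀ α β : ℝ, α < β →
      ∃ θ ∈ Set.Ioo α β, g (ζ * Complex.exp (θ * Complex.I)) ≠ ω) :
    Set.InjOn g (sphere 0 1) := by
  intro ζ hζ ζ' hζ' hgg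
  rw [mem_sphere_zero_iff_norm] at hζ hζ'
  by_contra hne
  have hζ0 : ζ ≠ 0 := by rintro rfl; simp at hζ
  set ω := g ζ with hω
  have hωn : ‖ω‖ = 1 := hgs ζ hζ
  obtain ⟨β, hβ0, hβ1, hβ⟩ : ∃ β : ℝ, 0 < β ∧ β < 2 * Real.pi ∧
      ζ * Complex.exp (β * Complex.I) = ζ' := by
    have hx : ζ⁻¹ * ζ' = Complex.exp ((ζ⁻¹ * ζ').arg * Complex.I) := by
      have := Complex.norm_mul_exp_arg_mul_I (ζ⁻¹ * ζ')
      rw [norm_mul, norm_inv, hζ, hζ', inv_one, one_mul, Complex.ofReal_one, one_mul] at this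
      exact this.symm
    have hx' : ζ * Complex.exp ((ζ⁻¹ * ζ').arg * Complex.I) = ζ' := by
      rw [← hx, mul_inv_cancel_left₀ hζ0]
    have b1 := Complex.neg_pi_lt_arg (ζ⁻¹ * ζ')
    have b2 := Complex.arg_le_pi (ζ⁻¹ * ζ')
    have hπ := Real.pi_pos
    rcases lt_trichotomy (ζ⁻¹ * ζ').arg 0 with h | h | h
    · refine ⟨(ζ⁻¹ * ζ').arg + 2 * Real.pi, by linarith, by linarith, ?_⟩
      push_cast
      rw [add_mul, Complex.exp_add, Complex.exp_two_pi_mul_I, mul_one]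
      exact hx'
    · rw [h] at hx'
      simp at hx'
      exact absurd hx' hne
    · exact ⟨_, h, by linarith, hx'⟩
  obtain ⟨α, ⟨hα0, hα1⟩, hα⟩ := hna ζ ω hζ hωn 0 β hβ0
  obtain ⟨γ, ⟨hγ0, hγ1⟩, hγ⟩ := hna ζ ω hζ hωn β (2 * Real.pi) hβ1
  set μ := (α + γ) / 2 with hμ
  set ν := (γ - α) / 2 with hν
  set l : ℂ → ℝ := fun z ↦ (z * conj ζ * Complex.exp ((-μ : ℝ) * Complex.I)).re - Real.cos ν
    with hl
  have hlc : Continuous l := by fun_prop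
  have hlθ : ∀ θ : ℝ, l (ζ * Complex.exp (θ * Complex.I)) = Real.cos (θ - μ) - Real.cos ν := by
    intro θ
    have : ζ * Complex.exp (θ * Complex.I) * conj ζ * Complex.exp ((-μ : ℝ) * Complex.I) =
        Complex.exp ((θ - μ : ℝ) * Complex.I) := by
      rw [mul_right_comm ζ, Complex.mul_conj, Complex.normSq_eq_norm_sq, hζ, mul_assoc,
        ← Complex.exp_add]
      push_cast
      rw [one_pow, one_mul]
      congr 1
      ring
    simp only [hl]
    rw [this, Complex.exp_ofReal_mul_I_re]
  have hl1 : l ζ < 0 := by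
    have := hlθ 0
    simp only [Complex.ofReal_zero, zero_mul, Complex.exp_zero, mul_one, zero_sub,
      Real.cos_neg] at this
    rw [this, sub_neg]
    exact cos_sub_lt_of_lt hα0 (by linarith) hγ1
  have hl2 : 0 < l ζ' := by
    rw [← hβ, hlθ, sub_pos]
    exact cos_lt_cos_sub_of_mem hα1 hγ0 (by linarith)
  set Z : Set ℂ := closedBall 0 1 ∩ {z | l z = 0} with hZ
  have hZc : IsCompact Z :=
    (isCompact_closedBall 0 1).inter_right (isClosed_eq hlc continuous_const)
  have hZω : ∀ z ∈ Z, g z ≠ ω := by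
    rintro z ⟨hz, hlz⟩ hgz
    rcases (mem_closedBall_zero_iff.1 hz).lt_or_eq with h | h
    · have h1 : ‖u z‖ < 1 := mem_ball_zero_iff.1
        (ht ▸ u.map_source (hs.symm ▸ mem_ball_zero_iff.2 h))
      rw [← hgu (mem_ball_zero_iff.2 h), hgz, hωn] at h1
      exact lt_irrefl _ h1
    · have hx : ζ * Complex.exp ((ζ⁻¹ * z).arg * Complex.I) = z := by
        have := Complex.norm_mul_exp_arg_mul_I (ζ⁻¹ * z)
        rw [norm_mul, norm_inv, hζ, h, inv_one, one_mul, Complex.ofReal_one, one_mul] at this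
        rw [this, mul_inv_cancel_left₀ hζ0]
      have hlz' : l z = 0 := hlz
      rw [← hx, hlθ, sub_eq_zero, eq_comm, Real.cos_eq_cos_iff] at hlz'
      obtain ⟨k, hk⟩ := hlz'
      have hper : ∀ θ : ℝ, (ζ⁻¹ * z).arg = 2 * k * Real.pi + θ ∨
          (ζ⁻¹ * z).arg = -(2 * k * Real.pi) + θ → z = ζ * Complex.exp (θ * Complex.I) := by
        intro θ hθ
        rw [← hx]
        congr 1
        rw [Complex.exp_eq_exp_iff_exists_int]
        rcases hθ with h | h
        · refine ⟨k, ?_⟩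
          rw [h]; push_cast; ring
        · refine ⟨-k, ?_⟩
          rw [h]; push_cast; ring
      rcases hk with hk | hk
      · refine hγ ?_
        rw [← hper γ (Or.inl (by rw [hμ, hν] at hk; linarith)), hgz]
      · refine hα ?_
        rw [← hper α (Or.inl (by rw [hμ, hν] at hk; linarith)), hgz]
  obtain ⟨η, hη, hηZ⟩ : ∃ η > 0, ∀ z ∈ Z, η ≤ ‖g z - ω‖ := by
    rcases Z.eq_empty_or_nonempty with h | h
    · exact ⟨1, one_pos, by simp [h]⟩
    · obtain ⟨z, hz, hmin⟩ := hZc.exists_isMinOn h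
        (f := fun z ↦ ‖g z - ω‖) (((hg.mono Set.inter_subset_left).sub continuousOn_const).norm)
      exact ⟨‖g z - ω‖, norm_pos_iff.2 (sub_ne_zero.2 (hZω z hz)), fun y hy ↦ hmin hy⟩
  set t := η ^ 2 / 4 with ht'
  have ht0 : 0 < t := by positivity
  set K : Set ℂ := ball 0 1 ∩ {v | 1 - t < (v * conj ω).re} with hK
  have hKc : Convex ℝ K := by
    refine (convex_ball _ _).inter (convex_halfSpace_gt ⟨fun x y ↦ ?_, fun a x ↦ ?_⟩ _)
    · rw [add_mul, Complex.add_re]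
    · rw [smul_mul_assoc, Complex.smul_re]
  have hKt : K ⊆ u.target := by rw [ht]; exact Set.inter_subset_left
  have hconn : IsPreconnected (u.symm '' K) :=
    hKc.isPreconnected.image _ (u.continuousOn_symm.mono hKt)
  have hωω : (ω * conj ω).re = 1 := by
    rw [Complex.mul_conj, Complex.normSq_eq_norm_sq, hωn]; simp
  have hnear : ∀ ξ : ℂ, ‖ξ‖ = 1 → g ξ = ω → ∀ P : Set ℂ, IsOpen P → ξ ∈ P →
      ∃ z ∈ u.symm '' K, z ∈ P := by
    intro ξ hξ hgξ P hP hξP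
    have hξc : ξ ∈ closedBall (0 : ℂ) 1 := mem_closedBall_zero_iff.2 hξ.le
    have h1 : Tendsto (fun z ↦ (g z * conj ω).re) (𝓝[ball 0 1] ξ) (𝓝 1) := by
      have : ContinuousWithinAt (fun z ↦ (g z * conj ω).re) (closedBall 0 1) ξ :=
        Complex.continuous_re.continuousAt.comp_continuousWithinAt
          ((hg ξ hξc).mul continuousWithinAt_const)
      have h2 := this.mono Metric.ball_subset_closedBall
      rw [ContinuousWithinAt, hgξ, hωω] at h2
      exact h2
    have hneb : (𝓝[ball (0 : ℂ) 1] ξ).NeBot := by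
      rw [← mem_closure_iff_nhdsWithin_neBot, closure_ball _ one_ne_zero]
      exact hξc
    obtain ⟨z, ⟨hz1, hz2⟩, hz3⟩ := (((h1.eventually_const_lt (u := 1 - t) (by linarith)).and
      (mem_nhdsWithin_of_mem_nhds (hP.mem_nhds hξP))).and self_mem_nhdsWithin).exists
    rw [hgu hz3] at hz1
    exact ⟨z, ⟨u z, ⟨ht ▸ u.map_source (hs.symm ▸ hz3), hz1⟩, u.left_inv (hs.symm ▸ hz3)⟩, hz2⟩
  obtain ⟨z1, hz1, hz1l⟩ := hnear ζ hζ rfl _ (isOpen_lt hlc continuous_const) hl1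
  obtain ⟨z2, hz2, hz2l⟩ := hnear ζ' hζ' hgg.symm _ (isOpen_lt continuous_const hlc) hl2
  obtain ⟨y, ⟨v, hv, rfl⟩, hyl⟩ := hconn.intermediate_value hz1 hz2 hlc.continuousOn
    ⟨hz1l.le, hz2l.le⟩
  have hyb : u.symm v ∈ ball (0 : ℂ) 1 := hs ▸ u.map_target (hKt hv)
  have h1 := hηZ _ ⟨Metric.ball_subset_closedBall hyb, hyl⟩
  rw [hgu hyb, u.right_inv (hKt hv)] at h1
  have h2 := norm_sub_sq_le_of_cap hωn (mem_ball_zero_iff.1 hv.1).le hv.2.le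
  have h3 : η ^ 2 ≤ ‖v - ω‖ ^ 2 := by gcongr
  rw [ht'] at h2
  have : 0 < η ^ 2 := by positivity
  linarith

end SphereHomeo

namespace SphereHomeo
open OnePoint Filter Topology
open Metric (ball closedBall sphere)

variable {u : OpenPartialHomeomorph ℂ ℂ}

/-- A self-homeomorphism of the disc satisfying the crosscut condition extends continuously. -/
lemma exists_extension_of_crosscut (hs : u.source = ball 0 1) (ht : u.target = ball 0 1)
    (hc : ∀ ζ : ℂ, ‖ζ‖ = 1 → ∀ δ > 0, ∀ ε > 0, ∃ r ∈ Set.Ioo (0 : ℝ) δ,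
      ∀ z ∈ ball (0 : ℂ) 1, ∀ w ∈ ball (0 : ℂ) 1,
        ‖z - ζ‖ = r → ‖w - ζ‖ = r → ‖u z - u w‖ < ε) :
    ∃ g : ℂ → ℂ, ContinuousOn g (closedBall 0 1) ∧ Set.EqOn g u (ball 0 1) ∧
      ∀ z, ‖z‖ = 1 → ‖g z‖ = 1 := by
  have huc : ContinuousOn u (ball 0 1) := hs ▸ u.continuousOn
  have hcl : closedBall (0 : ℂ) 1 ⊆ closure (ball 0 1) := by
    rw [closure_ball _ one_ne_zero]
  have hlim : ∀ ζ : ℂ, ‖ζ‖ = 1 → ∃ y, Tendsto u (𝓝[ball 0 1] ζ) (𝓝 y) := by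
    intro ζ hζ
    have : (𝓝[ball 0 1] ζ).NeBot :=
      mem_closure_iff_nhdsWithin_neBot.1 (hcl (mem_closedBall_zero_iff.2 hζ.le))
    refine cauchy_iff_exists_le_nhds.1 (Metric.cauchy_iff.2 ⟨inferInstance, fun ε hε ↦ ?_⟩)
    obtain ⟨r, hr0, hr⟩ := exists_cauchy_of_crosscut hs ht hζ (hc ζ hζ) hε
    refine ⟨u '' (ball ζ r ∩ ball 0 1), image_mem_map
      (inter_mem (mem_nhdsWithin_of_mem_nhds (Metric.ball_mem_nhds ζ hr0)) self_mem_nhdsWithin), ?_⟩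
    rintro _ ⟨z, ⟨hz, hz'⟩, rfl⟩ _ ⟨w, ⟨hw, hw'⟩, rfl⟩
    rw [dist_eq_norm]
    exact hr z hz' w hw' (mem_ball_iff_norm.1 hz) (mem_ball_iff_norm.1 hw)
  refine ⟨extendFrom (ball 0 1) u, continuousOn_extendFrom hcl fun ζ hζ ↦ ?_,
    extendFrom_extends huc, fun ζ hζ ↦ ?_⟩
  · rcases (mem_closedBall_zero_iff.1 hζ).lt_or_eq with h | h
    · exact ⟨_, huc ζ (mem_ball_zero_iff.2 h)⟩
    · exact hlim ζ h
  · have hne : (𝓝[ball 0 1] ζ).NeBot :=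
      mem_closure_iff_nhdsWithin_neBot.1 (hcl (mem_closedBall_zero_iff.2 hζ.le))
    have htd := (tendsto_extendFrom (hlim ζ hζ)).norm
    have hmem : ∀ᶠ z in 𝓝[ball 0 1] ζ, z ∈ ball (0 : ℂ) 1 := self_mem_nhdsWithin
    refine le_antisymm (le_of_tendsto htd (hmem.mono fun z hz ↦ ?_)) ?_
    · exact (mem_ball_zero_iff.1 (ht ▸ u.map_source (hs.symm ▸ hz))).le
    · by_contra! hlt
      obtain ⟨ρ, hρ0, hρ1⟩ := exists_between hlt
      obtain ⟨σ, hσ1, hσ⟩ := exists_norm_lt_of_norm_le hs ht hρ1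
      have h1 : ∀ᶠ z in 𝓝[ball 0 1] ζ, ‖u z‖ < ρ := htd.eventually_lt_const hρ0
      have h2 : ∀ᶠ z in 𝓝[ball 0 1] ζ, σ < ‖z‖ :=
        (continuous_norm.continuousWithinAt (s := ball 0 1) (x := ζ)).tendsto.eventually_const_lt
          (by rw [hζ]; exact hσ1)
      obtain ⟨z, hz, hz1, hz2⟩ := (hmem.and (h1.and h2)).exists
      exact absurd (hσ z hz hz1.le) (not_le.2 hz2)

/-- Radial extension of a map of the closed disc to the plane. -/
lemma exists_homeomorph_of_extension (hs : u.source = ball 0 1) (ht : u.target = ball 0 1)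
    {g : ℂ → ℂ} (hg : ContinuousOn g (closedBall 0 1)) (hgu : Set.EqOn g u (ball 0 1))
    (hgs : ∀ z, ‖z‖ = 1 → ‖g z‖ = 1) (hgi : Set.InjOn g (sphere 0 1)) :
    ∃ U : ℂ ≃ₜ ℂ, Set.EqOn U u (ball 0 1) ∧ (∀ z, ‖U z‖ < 1 ↔ ‖z‖ < 1) ∧
      ∀ z, ‖U z‖ = 1 ↔ ‖z‖ = 1 := by
  have hgb : ∀ z, ‖z‖ < 1 → ‖g z‖ < 1 := fun z hz ↦ by
    rw [hgu (mem_ball_zero_iff.2 hz)]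
    exact mem_ball_zero_iff.1 (ht ▸ u.map_source (hs.symm ▸ mem_ball_zero_iff.2 hz))
  have hinj : ∀ z w, ‖z‖ ≤ 1 → ‖w‖ ≤ 1 → g z = g w → z = w := by
    intro z w hz hw h
    rcases hz.lt_or_eq with hz | hz <;> rcases hw.lt_or_eq with hw | hw
    · rw [hgu (mem_ball_zero_iff.2 hz), hgu (mem_ball_zero_iff.2 hw)] at h
      exact u.injOn (hs.symm ▸ mem_ball_zero_iff.2 hz) (hs.symm ▸ mem_ball_zero_iff.2 hw) h
    · have := hgb z hz
      rw [h, hgs w hw] at this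
      exact absurd this (lt_irrefl _)
    · have := hgb w hw
      rw [← h, hgs z hz] at this
      exact absurd this (lt_irrefl _)
    · exact hgi (mem_sphere_zero_iff_norm.2 hz) (mem_sphere_zero_iff_norm.2 hw) h
  have hsurj : ∀ w : ℂ, ‖w‖ ≤ 1 → ∃ z, ‖z‖ ≤ 1 ∧ g z = w := by
    have h1 : IsClosed (g '' closedBall 0 1) :=
      ((isCompact_closedBall 0 1).image_of_continuousOn hg).isClosed
    have h2 : ball (0 : ℂ) 1 ⊆ g '' closedBall 0 1 := fun w hw ↦ by
      have h3 : u.symm w ∈ ball (0 : ℂ) 1 := hs ▸ u.map_target (ht.symm ▸ hw)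
      exact ⟨u.symm w, Metric.ball_subset_closedBall h3, by
        rw [hgu h3, u.right_inv (ht.symm ▸ hw)]⟩
    intro w hw
    have h3 := h1.closure_subset_iff.2 h2
    rw [closure_ball _ one_ne_zero] at h3
    obtain ⟨z, hz, hzw⟩ := h3 (mem_closedBall_zero_iff.2 hw)
    exact ⟨z, mem_closedBall_zero_iff.1 hz, hzw⟩
  set N : ℂ → ℝ := fun z ↦ max 1 ‖z‖ with hN
  have hN1 : ∀ z, 1 ≤ N z := fun z ↦ le_max_left _ _
  have hN0 : ∀ z, 0 < N z := fun z ↦ one_pos.trans_le (hN1 z)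
  have hNC : ∀ z, (N z : ℂ) ≠ 0 := fun z ↦ by exact_mod_cast (hN0 z).ne'
  have hNc : Continuous N := continuous_const.max continuous_norm
  have hNs : ∀ z, ‖z‖ ≤ 1 → N z = 1 := fun z hz ↦ max_eq_left hz
  have hNb : ∀ z, 1 ≤ ‖z‖ → N z = ‖z‖ := fun z hz ↦ max_eq_right hz
  have hnd : ∀ z, ‖z / N z‖ = ‖z‖ / N z := fun z ↦ by
    rw [norm_div, Complex.norm_real, Real.norm_of_nonneg (hN0 z).le]
  have hnd1 : ∀ z, ‖z / N z‖ ≤ 1 := fun z ↦ by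
    rw [hnd]
    exact div_le_one_of_le₀ (le_max_right _ _) (hN0 z).le
  set f : ℂ → ℂ := fun z ↦ N z * g (z / N z) with hf
  have hfc : Continuous f := by
    refine (Complex.continuous_ofReal.comp hNc).mul (hg.comp_continuous ?_ fun z ↦
      mem_closedBall_zero_iff.2 (hnd1 z))
    exact continuous_id.div (Complex.continuous_ofReal.comp hNc) hNC
  have hfs : ∀ z, ‖z‖ ≤ 1 → f z = g z := fun z hz ↦ by simp [hf, hNs z hz]
  have hfb : ∀ z, 1 ≤ ‖z‖ → ‖f z‖ = ‖z‖ := fun z hz ↦ by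
    have : ‖z / N z‖ = 1 := by
      rw [hnd, hNb z hz, div_self (by linarith)]
    simp only [hf]
    rw [norm_mul, hgs _ this, Complex.norm_real, Real.norm_of_nonneg (hN0 z).le, hNb z hz, mul_one]
  have hfl : ∀ z, ‖z‖ < 1 → ‖f z‖ < 1 := fun z hz ↦ by
    rw [hfs z hz.le]
    exact hgb z hz
  have hNf : ∀ z, N (f z) = N z := fun z ↦ by
    rcases lt_or_ge ‖z‖ 1 with h | h
    · rw [hNs _ (hfl z h).le, hNs z h.le]
    · rw [hNb z h, hNb _ (by rw [hfb z h]; exact h), hfb z h]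
  have hbij : Function.Bijective f := by
    constructor
    · intro z w h
      have h1 : N z = N w := by rw [← hNf z, ← hNf w, h]
      have h2 : g (z / N z) = g (w / N w) := by
        have : (N z : ℂ) * g (z / N z) = N w * g (w / N w) := h
        rw [h1] at this ⊢
        exact mul_left_cancel₀ (hNC w) this
      have h3 := hinj _ _ (hnd1 z) (hnd1 w) h2
      rw [h1] at h3
      exact (div_left_inj' (hNC w)).1 h3
    · intro w
      obtain ⟨y, hy, hyw⟩ := hsurj _ (hnd1 w)
      have h1 : N (N w * y) = N w := by
        have e : ‖(N w : ℂ) * y‖ = N w * ‖y‖ := by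
          rw [norm_mul, Complex.norm_real, Real.norm_of_nonneg (hN0 w).le]
        rcases le_total ‖w‖ 1 with h | h
        · rw [hNs w h]
          simpa using hNs y hy
        · have hy1 : ‖y‖ = 1 := by
            refine le_antisymm hy (not_lt.1 fun hlt ↦ ?_)
            have := hgb y hlt
            rw [hyw, hnd, hNb w h, div_self (by linarith)] at this
            exact lt_irrefl _ this
          rw [hNb _ (by rw [e, hy1, mul_one]; exact hN1 w), e, hy1, mul_one]
      refine ⟨N w * y, ?_⟩
      simp only [hf]
      rw [h1, mul_div_cancel_left₀ _ (hNC w), hyw, mul_div_cancel₀ _ (hNC w)]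
  have hprop : IsProperMap f := by
    refine isProperMap_iff_tendsto_cocompact.2 ⟨hfc, ?_⟩
    rw [← Metric.cobounded_eq_cocompact, ← tendsto_norm_atTop_iff_cobounded]
    refine (tendsto_norm_cobounded_atTop (E := ℂ)).congr' ?_
    filter_upwards [(tendsto_norm_cobounded_atTop (E := ℂ)).eventually_ge_atTop 1] with z hz
    exact (hfb z hz).symm
  let U : ℂ ≃ₜ ℂ := (Equiv.ofBijective f hbij).toHomeomorphOfIsInducing
    (IsClosedEmbedding.of_continuous_injective_isClosedMap hfc hbij.1
      hprop.isClosedMap).isInducing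
  have hUf : ∀ z, U z = f z := fun z ↦ rfl
  refine ⟨U, fun z hz ↦ ?_, fun z ↦ ?_, fun z ↦ ?_⟩
  · rw [hUf, hfs z (mem_ball_zero_iff.1 hz).le, hgu hz]
  · rw [hUf]
    refine ⟨fun h ↦ ?_, hfl z⟩
    by_contra! h1
    rw [hfb z h1] at h
    linarith
  · rw [hUf]
    refine ⟨fun h ↦ ?_, fun h ↦ by rw [hfb z h.ge, h]⟩
    rcases lt_or_ge ‖z‖ 1 with h1 | h1
    · exact absurd h (hfl z h1).ne
    · rw [← hfb z h1, h]

/-- Carathéodory: a homeomorphism of the plane becomes conformal near the origin after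
precomposition with a homeomorphism preserving the unit disc. -/
lemma exists_uniformization (h : ℂ ≃ₜ ℂ) : ∃ U : ℂ ≃ₜ ℂ,
    (∃ a ≠ 0, HasStrictDerivAt (h * U : ℂ ≃ₜ ℂ) a 0) ∧
    (∀ z, ‖U z‖ < 1 ↔ ‖z‖ < 1) ∧ ∀ z, ‖U z‖ = 1 ↔ ‖z‖ = 1 := by
  have hK : IsCompact (h '' closedBall 0 1) := (isCompact_closedBall 0 1).image h.continuous
  have hbd : Bornology.IsBounded (h '' ball 0 1) :=
    hK.isBounded.subset (Set.image_mono Metric.ball_subset_closedBall)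
  have hball : IsSimplyConnected (ball (0 : ℂ) 1) := by
    have := (convex_ball (0 : ℂ) 1).contractibleSpace ⟨0, by simp⟩
    exact (inferInstance : SimplyConnectedSpace (ball (0 : ℂ) 1))
  have hsc : IsSimplyConnected (h '' ball 0 1) :=
    h.isSimplyConnected_image.2 hball
  obtain ⟨φ, hφs, hφt, hφd, hφ0⟩ :=
    exists_conformal_of_disc (h.isOpen_image.2 Metric.isOpen_ball) hsc hbd
  set u : OpenPartialHomeomorph ℂ ℂ := φ.trans h.symm.toOpenPartialHomeomorph with hu
  have hua : ∀ z, u z = h.symm (φ z) := fun z ↦ rfl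
  have hus : u.source = ball 0 1 := by simp [hu, hφs]
  have hut : u.target = ball 0 1 := by
    ext z
    simp [hu, hφt]
  have hφm : ∀ z ∈ ball (0 : ℂ) 1, φ z ∈ h '' closedBall 0 1 := fun z hz ↦
    Set.image_mono Metric.ball_subset_closedBall (hφt ▸ φ.map_source (hφs.symm ▸ hz))
  have hφi : φ '' ball 0 1 = h '' ball 0 1 := by
    rw [← hφs, φ.image_source_eq_target, hφt, hφs]
  obtain ⟨g, hg, hgu, hgs⟩ := exists_extension_of_crosscut hus hut (by
    intro ζ hζ δ hδ ε hε
    obtain ⟨η, hη0, hη⟩ := Metric.uniformContinuousOn_iff.1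
      (hK.uniformContinuousOn_of_continuous h.symm.continuous.continuousOn) ε hε
    obtain ⟨r, hr, hr'⟩ := exists_short_crosscut_at hφd (hφs ▸ φ.injOn) (by rwa [hφi]) hζ hδ hη0
    refine ⟨r, hr, fun z hz w hw h1 h2 ↦ ?_⟩
    rw [hua, hua, ← dist_eq_norm]
    exact hη _ (hφm z hz) _ (hφm w hw) (by rw [dist_eq_norm]; exact hr' z hz w hw h1 h2))
  have hfφ : Set.EqOn (fun z ↦ h (g z)) φ (ball 0 1) := fun z hz ↦ by
    simp only [hgu hz, hua, Homeomorph.apply_symm_apply]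
  have hgi := injOn_sphere_of_extension hus hut hg hgu hgs (by
    intro ζ ω hζ hω α β hαβ
    by_contra! hc
    have hf : DiffContOnCl ℂ (fun z ↦ h (g z)) (ball 0 1) :=
      ⟨hφd.congr hfφ, by
        rw [closure_ball _ one_ne_zero]
        exact h.continuous.comp_continuousOn hg⟩
    have h0 : h (g 0) = h ω := eq_of_eqOn_arc hf hζ hαβ fun θ hθ ↦ by rw [hc θ hθ]
    have h1 : g 0 ∈ ball (0 : ℂ) 1 := by
      rw [hgu (by simp)]
      exact hut ▸ u.map_source (by simp [hus])
    rw [h.injective h0, mem_ball_zero_iff, hω] at h1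
    exact lt_irrefl _ h1)
  obtain ⟨U, hU, hU1, hU2⟩ := exists_homeomorph_of_extension hus hut hg hgu hgs hgi
  refine ⟨U, ⟨deriv φ 0, hφ0, ?_⟩, hU1, hU2⟩
  have hnh : ball (0 : ℂ) 1 ∈ 𝓝 0 := Metric.ball_mem_nhds 0 one_pos
  have hst : HasStrictDerivAt φ (deriv φ 0) 0 :=
    ((hφd.analyticOnNhd Metric.isOpen_ball) 0 (by simp)).hasStrictDerivAt
  refine hst.congr_of_eventuallyEq ?_
  filter_upwards [hnh] with z hz
  simp [hU hz, hua]

end SphereHomeo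

namespace SphereHomeo
open OnePoint Filter Topology
open Metric (ball closedBall sphere)

/-- The Cayley transform `z ↦ 2 i / (1 - z) - i` from the unit disc to the upper half plane. -/
noncomputable def cayley : OnePoint ℂ ≃ₜ OnePoint ℂ :=
  ptExt (aff (Units.mk0 (2 * Complex.I) (by simp)) (-Complex.I)) * inversion * ptExt (aff (-1) 1)

lemma cayley_one : cayley ((1 : ℂ) : OnePoint ℂ) = ∞ := by
  simp [cayley]

lemma cayley_infty : cayley ∞ = ((-Complex.I : ℂ) : OnePoint ℂ) := by
  simp [cayley]

lemma cayley_coe {z : ℂ} (hz : z ≠ 1) :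
    cayley z = ((2 * Complex.I * (1 - z)⁻¹ - Complex.I : ℂ) : OnePoint ℂ) := by
  rw [cayley, Homeomorph.mul_apply, Homeomorph.mul_apply, ptExt_coe, aff_apply,
    show ((-1 : ℂˣ) : ℂ) * z + 1 = 1 - z by push_cast; ring,
    inversion_coe_of_ne (sub_ne_zero.2 hz.symm), ptExt_coe, aff_apply, Units.val_mk0,
    ← sub_eq_add_neg]

lemma cayley_im {z : ℂ} (hz : z ≠ 1) :
    (2 * Complex.I * (1 - z)⁻¹ - Complex.I).im = (1 - ‖z‖ ^ 2) / Complex.normSq (1 - z) := by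
  have h : Complex.normSq (1 - z) ≠ 0 := by
    rw [Ne, Complex.normSq_eq_zero, sub_eq_zero]
    exact hz.symm
  rw [← Complex.normSq_eq_norm_sq, eq_div_iff h]
  simp only [Complex.sub_im, Complex.mul_im, Complex.mul_re, Complex.inv_re, Complex.inv_im,
    Complex.I_re, Complex.I_im, Complex.re_ofNat, Complex.im_ofNat, Complex.sub_re,
    Complex.one_re, Complex.one_im]
  field_simp
  simp only [Complex.normSq_apply, Complex.sub_re, Complex.sub_im, Complex.one_re, Complex.one_im]
  ring

lemma im_of_cayley_eq {x : OnePoint ℂ} {w : ℂ} (h : cayley x = w) :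
    (w.im = 0 ↔ ∃ z : ℂ, x = z ∧ ‖z‖ = 1) ∧ (0 ≤ w.im ↔ ∃ z : ℂ, x = z ∧ ‖z‖ ≤ 1) := by
  induction x with
  | infty =>
    rw [cayley_infty, OnePoint.coe_eq_coe] at h
    subst h
    simp
  | coe z =>
    have hz : z ≠ 1 := by
      rintro rfl
      rw [cayley_one] at h
      exact OnePoint.infty_ne_coe _ h
    have hp : 0 < Complex.normSq (1 - z) := by
      rw [Complex.normSq_pos, sub_ne_zero]
      exact hz.symm
    rw [cayley_coe hz, OnePoint.coe_eq_coe] at h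
    rw [← h, cayley_im hz]
    have hn := norm_nonneg z
    simp only [OnePoint.coe_eq_coe, exists_eq_left']
    constructor
    · rw [div_eq_zero_iff, or_iff_left hp.ne', sub_eq_zero, eq_comm,
        pow_eq_one_iff_of_nonneg hn two_ne_zero]
    · rw [le_div_iff₀ hp, zero_mul, sub_nonneg, sq_le_one_iff₀ hn]

section Abelian
variable {A : Type*} [CommGroup A] (π : (OnePoint ℂ ≃ₜ OnePoint ℂ) →* A)

lemma map_conjHomeo_mul_self : π (ptExt conjHomeo) * π (ptExt conjHomeo) = 1 := by
  have : conjHomeo * conjHomeo = 1 := by ext z; simp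
  rw [← map_mul, ← map_mul, this, map_one, map_one]

lemma map_of_preserves_disc (U : ℂ ≃ₜ ℂ) (h1 : ∀ z, ‖U z‖ < 1 ↔ ‖z‖ < 1)
    (h2 : ∀ z, ‖U z‖ = 1 ↔ ‖z‖ = 1) :
    π (ptExt U) = 1 ∨ π (ptExt U) = π (ptExt conjHomeo) := by
  have hU1 : ‖U 1‖ = 1 := (h2 1).2 (by simp)
  have h0 : U 1 ≠ 0 := by
    intro h
    simp [h] at hU1
  set U' : ℂ ≃ₜ ℂ := aff (Units.mk0 (U 1) h0)⁻¹ 0 * U with hU'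
  have hn : ∀ z, ‖U' z‖ = ‖U z‖ := fun z ↦ by simp [hU', hU1]
  have h1' : ∀ z, ‖U' z‖ ≤ 1 ↔ ‖z‖ ≤ 1 := fun z ↦ by
    rw [hn, le_iff_lt_or_eq, le_iff_lt_or_eq, h1, h2]
  have h2' : ∀ z, ‖U' z‖ = 1 ↔ ‖z‖ = 1 := fun z ↦ by rw [hn, h2]
  have hfix : U' 1 = 1 := by simp [hU', h0]
  obtain ⟨V, hV⟩ := exists_ptExt_eq (cayley * ptExt U' * cayley⁻¹) (by
    have : cayley⁻¹ ∞ = ((1 : ℂ) : OnePoint ℂ) := by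
      rw [← cayley_one, Homeomorph.inv_apply, Homeomorph.symm_apply_apply]
    rw [Homeomorph.mul_apply, Homeomorph.mul_apply, this, ptExt_coe, hfix, cayley_one])
  have hπ : π (ptExt U) = π (ptExt V) := by
    rw [hV, map_conj_eq, hU', map_mul, map_mul, map_aff, one_mul]
  have key : ∀ w : ℂ, ((V w).im = 0 ↔ w.im = 0) ∧ (0 ≤ (V w).im ↔ 0 ≤ w.im) := by
    intro w
    obtain ⟨x, hx⟩ := cayley.surjective w
    have hx' : cayley (ptExt U' x) = (V w : ℂ) := by
      rw [← ptExt_coe V, hV, ← hx]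
      simp
    obtain ⟨a1, a2⟩ := im_of_cayley_eq hx
    obtain ⟨b1, b2⟩ := im_of_cayley_eq hx'
    rw [a1, a2, b1, b2]
    induction x with
    | infty => simp
    | coe z => simp [h1', h2']
  rw [hπ]
  exact map_of_preserves_upper π V (fun z ↦ (key z).1) fun z ↦ (key z).2

/-- A homomorphism to an abelian group takes at most two values on homeomorphisms of the sphere. -/
theorem map_eq_one_or_eq_conj (h : OnePoint ℂ ≃ₜ OnePoint ℂ) :
    π h = 1 ∨ π h = π (ptExt conjHomeo) := by
  obtain ⟨m, hm1, hm⟩ := exists_moebius_to_infty π (h ∞)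
  obtain ⟨k, hk⟩ := exists_ptExt_eq (m * h) (by simpa using hm)
  have hπ : π h = π (ptExt k) := by rw [hk, map_mul, hm1, one_mul]
  obtain ⟨U, ⟨a, ha, hd⟩, h1, h2⟩ := exists_uniformization k
  have hΦ := map_of_hasStrictDerivAt π _ ha hd
  rw [map_mul, map_mul] at hΦ
  rw [hπ, eq_inv_of_mul_eq_one_left hΦ]
  rcases map_of_preserves_disc π U h1 h2 with h | h
  · left
    rw [h, inv_one]
  · right
    rw [h]
    exact inv_eq_of_mul_eq_one_left (map_conjHomeo_mul_self π)

end Abelian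

end SphereHomeo

namespace SphereHomeo
open OnePoint Filter Topology
open Metric (ball closedBall sphere)

section Lift
variable {X : Type*} [TopologicalSpace X] [SimplyConnectedSpace X] [LocallyPathConnectedSpace X]

lemma exists_continuous_exp_eq {g : X → ℂ} (hg : Continuous g) (h0 : ∀ x, g x ≠ 0) :
    ∃ F : X → ℂ, Continuous F ∧ ∀ x, Complex.exp (F x) = g x := by
  obtain ⟨x₀⟩ := (inferInstance : Nonempty X)
  obtain ⟨F, ⟨-, hF⟩, -⟩ := Complex.isCoveringMapOn_exp.existsUnique_continuousMap_lifts
    ⟨g, hg⟩ (Complex.exp_log (h0 x₀)) h0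
  exact ⟨F, F.continuous, fun x ↦ congrFun hF x⟩

lemma eq_of_exp_eq_exp {F G : X → ℂ} (hF : Continuous F) (hG : Continuous G)
    (h : ∀ x, Complex.exp (F x) = Complex.exp (G x)) {x₀ : X} (h₀ : F x₀ = G x₀) : F = G := by
  have := (Complex.isCoveringMapOn_exp.existsUnique_continuousMap_lifts
    ⟨fun x ↦ Complex.exp (F x), by fun_prop⟩ (a₀ := x₀) (e₀ := F x₀) rfl
    fun x ↦ Complex.exp_ne_zero _).unique (y₁ := ⟨F, hF⟩) (y₂ := ⟨G, hG⟩)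
    ⟨rfl, rfl⟩ ⟨h₀.symm, funext fun x ↦ (h x).symm⟩
  exact congrArg DFunLike.coe this

lemma exists_int_of_exp_eq_exp {F G : X → ℂ} (hF : Continuous F) (hG : Continuous G)
    (h : ∀ x, Complex.exp (F x) = Complex.exp (G x)) :
    ∃ n : ℤ, ∀ x, F x = G x + n * (2 * Real.pi * Complex.I) := by
  obtain ⟨x₀⟩ := (inferInstance : Nonempty X)
  obtain ⟨n, hn⟩ := Complex.exp_eq_exp_iff_exists_int.1 (h x₀)
  refine ⟨n, congrFun (eq_of_exp_eq_exp (x₀ := x₀) hF (by fun_prop) (fun x ↦ ?_) hn)⟩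
  rw [Complex.exp_add, Complex.exp_int_mul_two_pi_mul_I, mul_one, h]

end Lift

/-- `n` is the degree of `k`, the winding number of `k` around any of its values. -/
def IsDegree (k : ℂ ≃ₜ ℂ) (n : ℤ) : Prop :=
  ∃ F : ℂ × ℂ → ℂ, Continuous F ∧ (∀ q z, Complex.exp (F (q, z)) = k (q + Complex.exp z) - k q) ∧
    ∀ q z, F (q, z + 2 * Real.pi * Complex.I) = F (q, z) + n * (2 * Real.pi * Complex.I)

lemma exp_add_two_pi_I (z : ℂ) : Complex.exp (z + 2 * Real.pi * Complex.I) = Complex.exp z := by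
  rw [Complex.exp_add, Complex.exp_two_pi_mul_I, mul_one]

lemma exists_isDegree (k : ℂ ≃ₜ ℂ) : ∃ n, IsDegree k n := by
  obtain ⟨F, hF, hFk⟩ := exists_continuous_exp_eq (X := ℂ × ℂ)
    (g := fun p ↦ k (p.1 + Complex.exp p.2) - k p.1) (by fun_prop) fun p h ↦ by
      exact Complex.exp_ne_zero p.2 (add_eq_left.1 (k.injective (sub_eq_zero.1 h)))
  obtain ⟨n, hn⟩ := exists_int_of_exp_eq_exp (X := ℂ × ℂ)
    (F := fun p ↦ F (p.1, p.2 + 2 * Real.pi * Complex.I)) (G := F) (by fun_prop) hF fun p ↦ by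
      rw [hFk, hFk, exp_add_two_pi_I]
  exact ⟨n, F, hF, fun q z ↦ hFk (q, z), fun q z ↦ hn (q, z)⟩

lemma IsDegree.of_lift {k : ℂ ≃ₜ ℂ} {n m : ℤ} (h : IsDegree k n) {q : ℂ} {G : ℂ → ℂ}
    (hG : Continuous G) (hGk : ∀ z, Complex.exp (G z) = k (q + Complex.exp z) - k q)
    (hm : ∀ z, G (z + 2 * Real.pi * Complex.I) = G z + m * (2 * Real.pi * Complex.I)) : n = m := by
  obtain ⟨F, hF, hFk, hFn⟩ := h
  obtain ⟨j, hj⟩ := exists_int_of_exp_eq_exp (F := fun z ↦ F (q, z)) (by fun_prop) hG fun z ↦ by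
    rw [hFk, hGk]
  have h1 := hFn q 0
  rw [hj, hj, hm] at h1
  have h2 : (n : ℂ) * (2 * Real.pi * Complex.I) = m * (2 * Real.pi * Complex.I) := by
    linear_combination -h1
  exact_mod_cast mul_right_cancel₀ Complex.two_pi_I_ne_zero h2

lemma IsDegree.unique {k : ℂ ≃ₜ ℂ} {n m : ℤ} (h : IsDegree k n) (h' : IsDegree k m) : n = m := by
  obtain ⟨F, hF, hFk, hFn⟩ := h'
  exact h.of_lift (q := 0) (G := fun z ↦ F (0, z)) (by fun_prop) (hFk 0) (hFn 0)

lemma IsDegree.mul {k l : ℂ ≃ₜ ℂ} {n m : ℤ} (hk : IsDegree k n) (hl : IsDegree l m) :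
    IsDegree (k * l) (n * m) := by
  obtain ⟨F, hF, hFk, hFn⟩ := hk
  obtain ⟨G, hG, hGl, hGm⟩ := hl
  have hF1 : ∀ q z, ∀ j : ℕ, F (q, z + j * (2 * Real.pi * Complex.I)) =
      F (q, z) + j * n * (2 * Real.pi * Complex.I) := fun q z j ↦ by
    induction j with
    | zero => simp
    | succ j ih =>
      rw [show z + ((j + 1 : ℕ) : ℂ) * (2 * Real.pi * Complex.I) =
        z + j * (2 * Real.pi * Complex.I) + 2 * Real.pi * Complex.I by push_cast; ring, hFn, ih]
      push_cast
      ring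
  have hF2 : ∀ q z, ∀ j : ℤ, F (q, z + j * (2 * Real.pi * Complex.I)) =
      F (q, z) + j * n * (2 * Real.pi * Complex.I) := fun q z j ↦ by
    obtain ⟨j, rfl | rfl⟩ := j.eq_nat_or_neg
    · exact_mod_cast hF1 q z j
    · have := hF1 q (z + (-(j : ℤ) : ℤ) * (2 * Real.pi * Complex.I)) j
      rw [show z + (-(j : ℤ) : ℤ) * (2 * Real.pi * Complex.I) + j * (2 * Real.pi * Complex.I) = z by
        push_cast; ring] at this
      rw [this]
      push_cast
      ring
  refine ⟨fun p ↦ F (l p.1, G p), by fun_prop, fun q z ↦ ?_, fun q z ↦ ?_⟩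
  · rw [hFk, hGl]
    simp
  · simp only
    rw [hGm, hF2]
    push_cast
    ring

lemma isDegree_aff (a : ℂˣ) (b : ℂ) : IsDegree (aff a b) 1 := by
  refine ⟨fun p ↦ Complex.log a + p.2, by fun_prop, fun q z ↦ ?_, fun q z ↦ ?_⟩
  · simp only
    rw [Complex.exp_add, Complex.exp_log a.ne_zero]
    simp
    ring
  · push_cast
    ring

lemma isDegree_conjHomeo : IsDegree conjHomeo (-1) := by
  refine ⟨fun p ↦ (starRingEnd ℂ) p.2, by fun_prop, fun q z ↦ ?_, fun q z ↦ ?_⟩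
  · simp [Complex.exp_conj]
  · simp [map_ofNat]

lemma isDegree_one : IsDegree 1 1 := by
  have : aff 1 0 = 1 := by ext z; simp
  exact this ▸ isDegree_aff 1 0

/-- The degree of a homeomorphism of the plane. -/
noncomputable def degree (k : ℂ ≃ₜ ℂ) : ℤ := (exists_isDegree k).choose

lemma isDegree_degree (k : ℂ ≃ₜ ℂ) : IsDegree k (degree k) := (exists_isDegree k).choose_spec

lemma IsDegree.degree_eq {k : ℂ ≃ₜ ℂ} {n : ℤ} (h : IsDegree k n) : degree k = n :=
  (isDegree_degree k).unique h

lemma degree_mul (k l : ℂ ≃ₜ ℂ) : degree (k * l) = degree k * degree l :=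
  ((isDegree_degree k).mul (isDegree_degree l)).degree_eq

lemma degree_aff (a : ℂˣ) (b : ℂ) : degree (aff a b) = 1 := (isDegree_aff a b).degree_eq

lemma degree_one : degree 1 = 1 := isDegree_one.degree_eq

lemma degree_conjHomeo : degree conjHomeo = -1 := isDegree_conjHomeo.degree_eq

lemma degree_inversion_conj {k l : ℂ ≃ₜ ℂ} (hk : k 0 = 0)
    (h : ptExt l = inversion * ptExt k * inversion) : degree l = degree k := by
  have hl0 : l 0 = 0 := by
    have := congrArg (fun f : OnePoint ℂ ≃ₜ OnePoint ℂ ↦ f (0 : ℂ)) h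
    simpa using this
  have hl : ∀ z, z ≠ 0 → l z = (k z⁻¹)⁻¹ := fun z hz ↦ by
    have := congrArg (fun f : OnePoint ℂ ≃ₜ OnePoint ℂ ↦ f z) h
    have hk' : k z⁻¹ ≠ 0 := fun h ↦ inv_ne_zero hz (k.injective (h.trans hk.symm))
    simpa [inversion_coe_of_ne hz, inversion_coe_of_ne hk'] using this
  obtain ⟨F, hF, hFk, hFn⟩ := isDegree_degree k
  refine (isDegree_degree l).of_lift (q := 0) (G := fun z ↦ -F (0, -z)) (by fun_prop)
    (fun z ↦ ?_) fun z ↦ ?_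
  · rw [Complex.exp_neg, hFk, hl0, zero_add, zero_add, hl _ (Complex.exp_ne_zero z), hk,
      Complex.exp_neg, sub_zero, sub_zero]
  · have := hFn 0 (-(z + 2 * Real.pi * Complex.I))
    rw [show -(z + 2 * Real.pi * Complex.I) + 2 * Real.pi * Complex.I = -z by ring] at this
    rw [this]
    ring

/-- The group of Möbius transformations. -/
noncomputable def moebius : Subgroup (OnePoint ℂ ≃ₜ OnePoint ℂ) :=
  Subgroup.closure ({f | ∃ a b, f = ptExt (aff a b)} ∪ {inversion})

lemma ptExt_aff_mem (a : ℂˣ) (b : ℂ) : ptExt (aff a b) ∈ moebius :=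
  Subgroup.subset_closure (Or.inl ⟨a, b, rfl⟩)

lemma inversion_mem : inversion ∈ moebius := Subgroup.subset_closure (Or.inr rfl)

lemma exists_mem_moebius_apply_eq_infty (x : OnePoint ℂ) : ∃ m ∈ moebius, m x = ∞ := by
  induction x with
  | infty => exact ⟨1, one_mem _, rfl⟩
  | coe z =>
    exact ⟨inversion * ptExt (aff 1 (-z)), mul_mem inversion_mem (ptExt_aff_mem _ _), by simp⟩

lemma exists_gl_of_mem_moebius {m : OnePoint ℂ ≃ₜ OnePoint ℂ} (hm : m ∈ moebius) :
    ∃ g : GL (Fin 2) ℂ, ∀ x, m x = g • x := by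
  let N : Subgroup (OnePoint ℂ ≃ₜ OnePoint ℂ) :=
    { carrier := {m | ∃ g : GL (Fin 2) ℂ, ∀ x, m x = g • x}
      mul_mem' := by
        rintro f₁ f₂ ⟨g₁, h₁⟩ ⟨g₂, h₂⟩
        exact ⟨g₁ * g₂, fun x ↦ by rw [mul_smul, ← h₂, ← h₁, Homeomorph.mul_apply]⟩
      one_mem' := ⟨1, fun x ↦ by simp⟩
      inv_mem' := by
        rintro f ⟨g, h⟩
        refine ⟨g⁻¹, fun x ↦ ?_⟩
        rw [eq_inv_smul_iff, ← h, Homeomorph.inv_apply, Homeomorph.apply_symm_apply] }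
  have : moebius ≤ N := by
    rw [moebius, Subgroup.closure_le]
    rintro _ (⟨a, b, rfl⟩ | rfl)
    · refine ⟨Matrix.GeneralLinearGroup.mkOfDetNeZero !![(a : ℂ), b; 0, 1]
        (by simp [Matrix.det_fin_two]), fun x ↦ ?_⟩
      induction x with
      | infty => simp [OnePoint.smul_infty_eq_ite, Matrix.GeneralLinearGroup.mkOfDetNeZero]
      | coe z => simp [OnePoint.smul_some_eq_ite, Matrix.GeneralLinearGroup.mkOfDetNeZero]
    · refine ⟨Matrix.GeneralLinearGroup.mkOfDetNeZero !![(0 : ℂ), 1; 1, 0]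
        (by simp [Matrix.det_fin_two]), fun x ↦ ?_⟩
      induction x with
      | infty => simp [OnePoint.smul_infty_eq_ite, Matrix.GeneralLinearGroup.mkOfDetNeZero]
      | coe z =>
        simp [OnePoint.smul_some_eq_ite, Matrix.GeneralLinearGroup.mkOfDetNeZero, inversion_coe]
  exact this hm

lemma degree_eq_one_of_mem_moebius {k : ℂ ≃ₜ ℂ} (hk : ptExt k ∈ moebius) : degree k = 1 := by
  obtain ⟨g, hg⟩ := exists_gl_of_mem_moebius hk
  have h10 : g 1 0 = 0 := by
    rw [← OnePoint.smul_infty_eq_self_iff, ← hg, ptExt_infty]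
  have hdet := g.det_ne_zero
  rw [Matrix.det_fin_two, h10, mul_zero, sub_zero] at hdet
  have h00 := left_ne_zero_of_mul hdet
  have h11 := right_ne_zero_of_mul hdet
  have : k = aff (Units.mk0 (g 0 0 / g 1 1) (div_ne_zero h00 h11)) (g 0 1 / g 1 1) := by
    ext z
    have := hg z
    rw [ptExt_coe, OnePoint.smul_some_eq_ite] at this
    simp only [h10, zero_mul, zero_add, h11, if_false, OnePoint.coe_eq_coe] at this
    rw [this, aff_apply, Units.val_mk0]
    ring
  rw [this, degree_aff]

lemma exists_moebius_mul_eq {m : OnePoint ℂ ≃ₜ OnePoint ℂ} (hm : m ∈ moebius) (k : ℂ ≃ₜ ℂ) :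
    ∃ m' ∈ moebius, ∃ k', ptExt k * m = m' * ptExt k' ∧ degree k' = degree k := by
  have haff : ∀ a b, ∀ k : ℂ ≃ₜ ℂ, ∃ m' ∈ moebius, ∃ k',
      ptExt k * ptExt (aff a b) = m' * ptExt k' ∧ degree k' = degree k := fun a b k ↦
    ⟨1, one_mem _, k * aff a b, by simp, by simp [degree_mul, degree_aff]⟩
  have hinv : ∀ k : ℂ ≃ₜ ℂ, ∃ m' ∈ moebius, ∃ k',
      ptExt k * inversion = m' * ptExt k' ∧ degree k' = degree k := fun k ↦ by
    set l := aff 1 (-k 0) * k with hl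
    have hl0 : l 0 = 0 := by simp [hl]
    obtain ⟨k', hk'⟩ := exists_ptExt_eq (inversion * ptExt l * inversion) (by simp [hl0])
    refine ⟨ptExt (aff 1 (k 0)) * inversion, mul_mem (ptExt_aff_mem _ _) inversion_mem, k', ?_, ?_⟩
    · rw [hk']
      have : k = aff 1 (k 0) * l := by ext z; simp [hl]
      conv_lhs => rw [this, map_mul]
      ext x
      simp
    · rw [degree_inversion_conj hl0 hk', hl, degree_mul, degree_aff, one_mul]
  induction hm using Subgroup.closure_induction'' generalizing k with
  | mem x hx =>
    obtain ⟨a, b, rfl⟩ | rfl := hx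
    · exact haff a b k
    · exact hinv k
  | inv_mem x hx =>
    obtain ⟨a, b, rfl⟩ | rfl := hx
    · have : (aff a b)⁻¹ = aff a⁻¹ (-((a⁻¹ : ℂˣ) * b)) := by
        ext z
        simp
        ring
      rw [← map_inv, this]
      exact haff _ _ k
    · exact hinv k
  | one => exact ⟨1, one_mem _, k, by simp⟩
  | mul x y hx hy ihx ihy =>
    obtain ⟨m₁, hm₁, k₁, h₁, hd₁⟩ := ihx k
    obtain ⟨m₂, hm₂, k₂, h₂, hd₂⟩ := ihy k₁
    exact ⟨m₁ * m₂, mul_mem hm₁ hm₂, k₂, by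
      rw [← mul_assoc, h₁, mul_assoc, h₂, mul_assoc], hd₂.trans hd₁⟩

lemma exists_moebius_mul_ptExt_eq (h : OnePoint ℂ ≃ₜ OnePoint ℂ) :
    ∃ k, ∃ m ∈ moebius, h = m * ptExt k := by
  obtain ⟨m, hm, hmh⟩ := exists_mem_moebius_apply_eq_infty (h ∞)
  obtain ⟨k, hk⟩ := exists_ptExt_eq (m * h) (by simpa using hmh)
  exact ⟨k, m⁻¹, inv_mem hm, by rw [hk, inv_mul_cancel_left]⟩

lemma degree_eq_of_moebius_mul_eq {m m' : OnePoint ℂ ≃ₜ OnePoint ℂ} (hm : m ∈ moebius)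
    (hm' : m' ∈ moebius) {k k' : ℂ ≃ₜ ℂ} (h : m * ptExt k = m' * ptExt k') :
    degree k = degree k' := by
  have h1 : ptExt (k * k'⁻¹) = m⁻¹ * m' := by
    rw [map_mul, map_inv, mul_inv_eq_iff_eq_mul, mul_assoc, ← h, inv_mul_cancel_left]
  have h2 := degree_eq_one_of_mem_moebius (h1 ▸ mul_mem (inv_mem hm) hm')
  rw [← inv_mul_cancel_right k k', degree_mul, h2, one_mul]

/-- The orientation character of the sphere. -/
noncomputable def orientation : (OnePoint ℂ ≃ₜ OnePoint ℂ) →* ℤ where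
  toFun h := degree (exists_moebius_mul_ptExt_eq h).choose
  map_one' := by
    obtain ⟨m, hm, h⟩ := (exists_moebius_mul_ptExt_eq 1).choose_spec
    rw [← degree_one]
    exact degree_eq_of_moebius_mul_eq hm (one_mem moebius) (by rw [← h, map_one, one_mul])
  map_mul' f g := by
    obtain ⟨m, hm, h⟩ := (exists_moebius_mul_ptExt_eq (f * g)).choose_spec
    obtain ⟨m₁, hm₁, h₁⟩ := (exists_moebius_mul_ptExt_eq f).choose_spec
    obtain ⟨m₂, hm₂, h₂⟩ := (exists_moebius_mul_ptExt_eq g).choose_spec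
    set k₁ := (exists_moebius_mul_ptExt_eq f).choose
    set k₂ := (exists_moebius_mul_ptExt_eq g).choose
    obtain ⟨m₃, hm₃, k₃, h₃, hd⟩ := exists_moebius_mul_eq hm₂ k₁
    rw [← hd, ← degree_mul]
    refine degree_eq_of_moebius_mul_eq hm (mul_mem hm₁ hm₃) ?_
    rw [← h]
    nth_rewrite 1 [h₁, h₂]
    rw [map_mul, mul_assoc, ← mul_assoc _ m₂, h₃, mul_assoc, mul_assoc]

lemma orientation_ptExt (k : ℂ ≃ₜ ℂ) : orientation (ptExt k) = degree k := by
  obtain ⟨m, hm, h⟩ := (exists_moebius_mul_ptExt_eq (ptExt k)).choose_spec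
  exact degree_eq_of_moebius_mul_eq hm (one_mem moebius) (by rw [← h, one_mul])

/-- Complex conjugation is not a product of commutators. -/
theorem conj_notMem_commutator : ptExt conjHomeo ∉ commutator (OnePoint ℂ ≃ₜ OnePoint ℂ) := by
  intro h
  have := Abelianization.commutator_subset_ker orientation.toHomUnits h
  rw [MonoidHom.mem_ker, Units.ext_iff, MonoidHom.coe_toHomUnits, orientation_ptExt,
    degree_conjHomeo] at this
  norm_num at this

end SphereHomeo

namespace SphereHomeo
open OnePoint Filter Topology

theorem index_commutator_onePoint : (commutator (OnePoint ℂ ≃ₜ OnePoint ℂ)).index = 2 := by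
  rw [Subgroup.index_eq_two_iff]
  refine ⟨ptExt conjHomeo, fun h ↦ ?_⟩
  simp only [← Abelianization.ker_of, MonoidHom.mem_ker, map_mul]
  have hc : Abelianization.of (ptExt conjHomeo) ≠ 1 := fun hc ↦
    conj_notMem_commutator (by rw [← Abelianization.ker_of]; exact hc)
  rcases map_eq_one_or_eq_conj Abelianization.of h with h1 | h1
  · right
    simpa [h1] using hc
  · left
    rw [h1]
    exact ⟨map_conjHomeo_mul_self _, hc⟩

/-- A homeomorphism of spaces induces an isomorphism of their homeomorphism groups. -/
def homeoCongr {X Y : Type*} [TopologicalSpace X] [TopologicalSpace Y] (e : X ≃ₜ Y) :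
    (X ≃ₜ X) ≃* (Y ≃ₜ Y) where
  toFun f := (e.symm.trans f).trans e
  invFun f := (e.trans f).trans e.symm
  left_inv f := by ext x; simp
  right_inv f := by ext x; simp
  map_mul' f g := by ext x; simp

lemma index_commutator_eq_of_mulEquiv {G H : Type*} [Group G] [Group H] (e : G ≃* H) :
    (commutator G).index = (commutator H).index := by
  have : (commutator G).map (e : G →* H) = commutator H := by
    rw [commutator_def, commutator_def, Subgroup.map_commutator,
      Subgroup.map_top_of_surjective _ e.surjective]
  rw [← this]
  exact (Subgroup.index_map_equiv _ e).symm

end SphereHomeo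

/-- The commutator subgroup of `Homeo(S²)` has index `2`. -/
theorem commutator_homeo_sphere_index_eq_two :
    (commutator
      ((Metric.sphere (0 : EuclideanSpace ℝ (Fin 3)) 1) ≃ₜ
        (Metric.sphere (0 : EuclideanSpace ℝ (Fin 3)) 1))).index = 2 := by
  have e : OnePoint ℂ ≃ₜ Metric.sphere (0 : EuclideanSpace ℝ (Fin 3)) 1 :=
    onePointEquivSphereOfFinrankEq (by simp [Complex.finrank_real_complex])
  rw [← SphereHomeo.index_commutator_eq_of_mulEquiv (SphereHomeo.homeoCongr e)]
  exact SphereHomeo.index_commutator_onePoint
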